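/- arXiv:math/0203094 — 3 statements merged into one kernel-verified Lean document; each statement's English description precedes it below -/
import Mathlib

section
/- For every nonnegative integer L and nonzero z with 1+z ≠ 0, the finite sum ∑_{n=0}^{L} q^{T_n} (z^{-n} + z^{1+n})/(1+z) equals the triple sum ∑_{i,j,k≥0} q^{T_i+T_j+T_k} z^{i-j} (-1)^k [L-i choose j]_q [L-j choose k]_q [L-k choose i]_q, where T_n = n(n+1)/2 and [m choose n]_q denotes the Gaussian binomial coefficient (interpreted as 0 when m < n or n < 0). This is an identity of Laurent polynomials in z and q. -/
/-- The q-Pochhammer symbol `(a;q)_n = ∏_{m=0}^{n-1} (1 - a q^m)`. -/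
noncomputable def qPoch {K : Type*} [Field K] (a q : K) (n : ℕ) : K :=
  ∏ m ∈ Finset.range n, (1 - a * q ^ m)

/-- The Gaussian binomial coefficient `[m choose n]_q`, interpreted as `0`
when `n < 0` or `m < n`. -/
noncomputable def qbinom {K : Type*} [Field K] (q : K) (m n : ℤ) : K :=
  if 0 ≤ n ∧ n ≤ m then
    qPoch q q m.toNat / (qPoch q q n.toNat * qPoch q q (m - n).toNat)
  else 0

/-- Triangular numbers `T n = n(n+1)/2`. -/
def T (n : ℕ) : ℕ := n * (n + 1) / 2

open Finset

lemma T_succ (n : ℕ) : T (n + 1) = T n + (n + 1) := by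
  unfold T
  rw [show (n + 1) * (n + 1 + 1) = n * (n + 1) + (n + 1) * 2 by ring,
    Nat.add_mul_div_right _ _ (by norm_num)]

section GaussianBinomial

variable {K : Type*} [Field K]

lemma qPoch_zero (a q : K) : qPoch a q 0 = 1 := by simp [qPoch]

lemma qPoch_self_succ (q : K) (n : ℕ) :
    qPoch q q (n + 1) = qPoch q q n * (1 - q ^ (n + 1)) := by
  simp [qPoch, prod_range_succ, pow_succ']

lemma qPoch_self_ne_zero {q : K} {M : ℕ} (hq : ∀ n : ℕ, 1 ≤ n → n ≤ M → q ^ n ≠ 1) :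
    ∀ n ≤ M, qPoch q q n ≠ 0 := by
  intro n hn
  unfold qPoch
  rw [prod_ne_zero_iff]
  intro m hm
  rw [← pow_succ', sub_ne_zero]
  exact (hq (m + 1) (by omega) (by have := mem_range.mp hm; omega)).symm

/-- The Gaussian binomial coefficient with natural number arguments. -/
noncomputable def natQbinom (q : K) (m n : ℕ) : K :=
  if n ≤ m then qPoch q q m / (qPoch q q n * qPoch q q (m - n)) else 0

lemma qbinom_sub_natCast (q : K) {m i : ℕ} (n : ℕ) (h : i ≤ m) :
    qbinom q ((m : ℤ) - i) n = natQbinom q (m - i) n := by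
  unfold qbinom natQbinom
  rw [← Nat.cast_sub h]
  by_cases hn : n ≤ m - i
  · rw [if_pos ⟨by positivity, by exact_mod_cast hn⟩, if_pos hn, ← Nat.cast_sub hn]
    simp only [Int.toNat_natCast]
  · rw [if_neg (fun h' => hn (by exact_mod_cast h'.2)), if_neg hn]

lemma natQbinom_eq_zero (q : K) {m n : ℕ} (h : m < n) : natQbinom q m n = 0 :=
  if_neg (by omega)

lemma natQbinom_add (q : K) (m n : ℕ) :
    natQbinom q (n + m) n = qPoch q q (n + m) / (qPoch q q n * qPoch q q m) := by
  simp [natQbinom]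

lemma natQbinom_zero_right {q : K} {m : ℕ} (h : qPoch q q m ≠ 0) : natQbinom q m 0 = 1 := by
  simp [natQbinom, qPoch_zero, h]

lemma natQbinom_self {q : K} {m : ℕ} (h : qPoch q q m ≠ 0) : natQbinom q m m = 1 := by
  simp [natQbinom, qPoch_zero, h]

variable {q : K} {M : ℕ}

lemma natQbinom_succ_succ (hP : ∀ n ≤ M, qPoch q q n ≠ 0) {m : ℕ} (hm : m + 1 ≤ M) (n : ℕ) :
    natQbinom q (m + 1) (n + 1) = natQbinom q m n + q ^ (n + 1) * natQbinom q m (n + 1) := by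
  rcases lt_trichotomy m n with h | rfl | h
  · simp [natQbinom_eq_zero q h, natQbinom_eq_zero q (Nat.lt_succ_of_lt h),
      natQbinom_eq_zero q (Nat.succ_lt_succ h)]
  · simp [natQbinom_self (hP m (by omega)), natQbinom_self (hP _ hm),
      natQbinom_eq_zero q (Nat.lt_succ_self m)]
  · obtain ⟨d, rfl⟩ := Nat.exists_eq_add_of_lt h
    have h₁ := hP (n + 1) (by omega)
    have h₂ := hP (d + 1) (by omega)
    rw [show n + d + 1 + 1 = n + 1 + (d + 1) by ring, natQbinom_add,
      show n + d + 1 = n + (d + 1) by ring, natQbinom_add,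
      show n + (d + 1) = n + 1 + d by ring, natQbinom_add,
      show n + 1 + (d + 1) = n + 1 + d + 1 by ring, qPoch_self_succ q (n + 1 + d)]
    rw [qPoch_self_succ] at h₁ h₂ ⊢
    rw [qPoch_self_succ q d]
    obtain ⟨h₁, h₁'⟩ := mul_ne_zero_iff.mp h₁
    obtain ⟨h₂, h₂'⟩ := mul_ne_zero_iff.mp h₂
    field_simp
    ring

lemma natQbinom_succ_succ' (hP : ∀ n ≤ M, qPoch q q n ≠ 0) {m : ℕ} (hm : m + 1 ≤ M) {n : ℕ}
    (hn : n ≤ m) :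
    natQbinom q (m + 1) (n + 1) = natQbinom q m (n + 1) + q ^ (m - n) * natQbinom q m n := by
  rcases hn.eq_or_lt with rfl | h
  · simp [natQbinom_self (hP n (by omega)), natQbinom_self (hP _ hm),
      natQbinom_eq_zero q (Nat.lt_succ_self n)]
  · obtain ⟨d, rfl⟩ := Nat.exists_eq_add_of_lt h
    have h₁ := hP (n + 1) (by omega)
    have h₂ := hP (d + 1) (by omega)
    rw [show n + d + 1 - n = d + 1 by omega,
      show n + d + 1 + 1 = n + 1 + (d + 1) by ring, natQbinom_add,
      show n + d + 1 = n + (d + 1) by ring, natQbinom_add,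
      show n + (d + 1) = n + 1 + d by ring, natQbinom_add,
      show n + 1 + (d + 1) = n + 1 + d + 1 by ring, qPoch_self_succ q (n + 1 + d)]
    rw [qPoch_self_succ] at h₁ h₂ ⊢
    rw [qPoch_self_succ q d]
    obtain ⟨h₁, h₁'⟩ := mul_ne_zero_iff.mp h₁
    obtain ⟨h₂, h₂'⟩ := mul_ne_zero_iff.mp h₂
    field_simp
    ring

variable (q) in
/-- The coefficient of `x ^ (m - i)` in `(x q; q)_n / (x; q)_{i+1}`, for `n ≤ m`. -/
noncomputable def alternatingSum (n m i : ℕ) : K :=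
  ∑ k ∈ range (n + 1), (-1) ^ k * q ^ T k * natQbinom q n k * natQbinom q (m - k) i

lemma alternatingSum_eq_sum_range {n m N : ℕ} (h : n + 1 ≤ N) (i : ℕ) :
    alternatingSum q n m i =
      ∑ k ∈ range N, (-1) ^ k * q ^ T k * natQbinom q n k * natQbinom q (m - k) i := by
  refine sum_subset (range_mono h) fun k _ hk => ?_
  rw [natQbinom_eq_zero q (show n < k by simpa using hk)]
  simp

lemma alternatingSum_succ_left (hP : ∀ n ≤ M, qPoch q q n ≠ 0) {n : ℕ} (hn : n + 1 ≤ M)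
    (m i : ℕ) :
    alternatingSum q (n + 1) (m + 1) i =
      alternatingSum q n (m + 1) i - q ^ (n + 1) * alternatingSum q n m i := by
  rw [alternatingSum_eq_sum_range (show n + 1 ≤ n + 1 + 1 by omega) (m := m + 1)]
  unfold alternatingSum
  rw [sum_range_succ' _ (n + 1), sum_range_succ' _ (n + 1), mul_sum,
    natQbinom_zero_right (hP _ hn), natQbinom_zero_right (hP n (by omega)), add_sub_right_comm,
    ← sum_sub_distrib]
  congr 1
  refine sum_congr rfl fun k hk => ?_
  have hk : k ≤ n := Nat.lt_succ_iff.mp (mem_range.mp hk)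
  obtain ⟨d, rfl⟩ := Nat.exists_eq_add_of_le hk
  rw [natQbinom_succ_succ' hP hn hk, T_succ, Nat.add_sub_add_right, Nat.add_sub_cancel_left]
  ring

lemma alternatingSum_succ_right (hP : ∀ n ≤ M, qPoch q q n ≠ 0) {n m : ℕ} (hn : n ≤ m)
    (hm : m + 1 ≤ M) (i : ℕ) :
    alternatingSum q n (m + 1) (i + 1) =
      alternatingSum q n m i + q ^ (i + 1) * alternatingSum q n m (i + 1) := by
  unfold alternatingSum
  rw [mul_sum, ← sum_add_distrib]
  refine sum_congr rfl fun k hk => ?_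
  have hk : k ≤ n := Nat.lt_succ_iff.mp (mem_range.mp hk)
  rw [Nat.sub_add_comm (hk.trans hn), natQbinom_succ_succ hP (by omega)]
  ring

lemma alternatingSum_self (hP : ∀ n ≤ M, qPoch q q n ≠ 0) {n : ℕ} (hn : n ≤ M) :
    alternatingSum q n n n = 1 := by
  unfold alternatingSum
  rw [sum_range_succ', sum_eq_zero]
  · simp [natQbinom_zero_right (hP n hn), natQbinom_self (hP n hn), T]
  · intro k hk
    rw [natQbinom_eq_zero q (show n - (k + 1) < n by have := mem_range.mp hk; omega), mul_zero]

lemma alternatingSum_eq_one (hP : ∀ n ≤ M, qPoch q q n ≠ 0) (i : ℕ) :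
    ∀ m, i ≤ m → m ≤ M → alternatingSum q i m i = 1 := by
  induction i with
  | zero =>
    intro m _ hm
    simp [alternatingSum, natQbinom_zero_right (hP m hm), natQbinom_zero_right (hP 0 (by omega)),
      T]
  | succ i ih =>
    intro m hm
    induction m, hm using Nat.le_induction with
    | base => exact alternatingSum_self hP
    | succ m hm ihm =>
      intro hM
      obtain ⟨l, rfl⟩ := Nat.exists_eq_add_of_le' hm
      rw [alternatingSum_succ_right hP hm hM, ihm (by omega), ← add_assoc,
        alternatingSum_succ_left hP (by omega), ih _ (by omega) (by omega),
        ih _ (by omega) (by omega)]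
      ring

lemma alternatingSum_eq (hP : ∀ n ≤ M, qPoch q q n ≠ 0) {i n : ℕ} (hn : i ≤ n) :
    ∀ m, n ≤ m → m ≤ M → alternatingSum q n m i = qPoch q q n / qPoch q q i := by
  induction n, hn using Nat.le_induction with
  | base =>
    intro m hm hM
    rw [alternatingSum_eq_one hP i m hm hM, div_self (hP i (by omega))]
  | succ n hn ih =>
    intro m hm hM
    obtain ⟨l, rfl⟩ : ∃ l, m = l + 1 := ⟨m - 1, by omega⟩
    rw [alternatingSum_succ_left hP (by omega), ih _ (by omega) hM, ih _ (by omega) (by omega),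
      qPoch_self_succ]
    ring

variable (q) in
/-- The coefficient of `z ^ (i - j)` obtained from the triple sum after summing over `k`. -/
noncomputable def doubleCoeff (L i j : ℕ) : K :=
  if i + j ≤ L then
    q ^ (T i + T j) * (qPoch q q (L - i) * qPoch q q (L - j)) /
      (qPoch q q i * qPoch q q j * qPoch q q (L - i - j))
  else 0

lemma doubleCoeff_eq_zero {L i j : ℕ} (h : L < i + j) : doubleCoeff q L i j = 0 :=
  if_neg (by omega)

lemma doubleCoeff_add (i j r : ℕ) :
    doubleCoeff q (i + j + r) i j =
      q ^ (T i + T j) * (qPoch q q (j + r) * qPoch q q (i + r)) /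
        (qPoch q q i * qPoch q q j * qPoch q q r) := by
  unfold doubleCoeff
  rw [if_pos (by omega), show i + j + r - i = j + r by omega, show i + j + r - j = i + r by omega,
    show j + r - j = r by omega]

lemma doubleCoeff_comm (L i j : ℕ) : doubleCoeff q L i j = doubleCoeff q L j i := by
  unfold doubleCoeff
  rw [add_comm i j, add_comm (T i), mul_comm (qPoch q q (L - i)), mul_comm (qPoch q q i),
    Nat.sub_right_comm]

lemma doubleCoeff_succ_succ (hP : ∀ n ≤ M, qPoch q q n ≠ 0) {L : ℕ} (hL : L + 2 ≤ M) (i j : ℕ) :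
    doubleCoeff q (L + 2) (i + 1) (j + 1) =
      (1 - q ^ (L + 2)) * doubleCoeff q (L + 1) (i + 1) (j + 1) +
        q ^ (L + 2) * doubleCoeff q L i j := by
  rcases lt_trichotomy L (i + j) with h | rfl | h
  · rw [doubleCoeff_eq_zero h, doubleCoeff_eq_zero (by omega), doubleCoeff_eq_zero (by omega)]
    ring
  · rw [doubleCoeff_eq_zero (show i + j + 1 < i + 1 + (j + 1) by omega),
      show i + j + 2 = i + 1 + (j + 1) + 0 by ring, doubleCoeff_add]
    have := doubleCoeff_add (q := q) i j 0
    rw [add_zero] at this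
    rw [this]
    have h₁ := hP i (by omega)
    have h₂ := hP j (by omega)
    have h₃ := hP (i + 1) (by omega)
    have h₄ := hP (j + 1) (by omega)
    simp only [add_zero, qPoch_zero, T_succ]
    field_simp
    ring
  · obtain ⟨s, rfl⟩ := Nat.exists_eq_add_of_lt h
    have h₁ := hP (i + 1) (by omega)
    have h₂ := hP (j + 1) (by omega)
    have h₃ := hP (s + 1) (by omega)
    have e := doubleCoeff_add (q := q) i j (s + 1)
    have e' := doubleCoeff_add (q := q) (i + 1) (j + 1) s
    have e'' := doubleCoeff_add (q := q) (i + 1) (j + 1) (s + 1)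
    rw [show i + j + (s + 1) = i + j + s + 1 by ring] at e
    rw [show i + 1 + (j + 1) + s = i + j + s + 1 + 1 by ring] at e'
    rw [show i + 1 + (j + 1) + (s + 1) = i + j + s + 1 + 2 by ring] at e''
    rw [e, e', e'', show j + 1 + (s + 1) = j + s + 1 + 1 by ring,
      show i + 1 + (s + 1) = i + s + 1 + 1 by ring, show j + (s + 1) = j + s + 1 by ring,
      show i + (s + 1) = i + s + 1 by ring, show j + 1 + s = j + s + 1 by ring,
      show i + 1 + s = i + s + 1 by ring, qPoch_self_succ q (j + s + 1),
      qPoch_self_succ q (i + s + 1)]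
    rw [qPoch_self_succ] at h₁ h₂ h₃
    rw [qPoch_self_succ q i, qPoch_self_succ q j, qPoch_self_succ q s, T_succ, T_succ]
    obtain ⟨h₁, h₁'⟩ := mul_ne_zero_iff.mp h₁
    obtain ⟨h₂, h₂'⟩ := mul_ne_zero_iff.mp h₂
    obtain ⟨h₃, h₃'⟩ := mul_ne_zero_iff.mp h₃
    field_simp
    ring

lemma doubleCoeff_zero_right_of_le (hP : ∀ n ≤ M, qPoch q q n ≠ 0) {L i : ℕ} (hL : L ≤ M)
    (hi : i ≤ L) : doubleCoeff q L i 0 = q ^ T i * qPoch q q L / qPoch q q i := by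
  have := hP (L - i) (by omega)
  have := hP i (by omega)
  simp only [doubleCoeff, add_zero, if_pos hi, Nat.sub_zero, qPoch_zero, T, zero_mul,
    Nat.zero_div]
  field_simp

lemma doubleCoeff_zero_right (hP : ∀ n ≤ M, qPoch q q n ≠ 0) {L : ℕ} (hL : L + 1 ≤ M) (i : ℕ) :
    doubleCoeff q (L + 1) i 0 =
      (1 - q ^ (L + 1)) * doubleCoeff q L i 0 + if i = L + 1 then q ^ T (L + 1) else 0 := by
  rcases lt_trichotomy i (L + 1) with h | rfl | h
  · rw [doubleCoeff_zero_right_of_le hP hL h.le,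
      doubleCoeff_zero_right_of_le hP (by omega) (by omega), if_neg h.ne, qPoch_self_succ]
    ring
  · rw [doubleCoeff_zero_right_of_le hP hL le_rfl, doubleCoeff_eq_zero (by omega), if_pos rfl,
      mul_div_assoc, div_self (hP _ hL)]
    ring
  · rw [doubleCoeff_eq_zero (by omega), doubleCoeff_eq_zero (by omega), if_neg h.ne']
    ring

variable (q) in
/-- The generating function of `doubleCoeff q L i j` with respect to `i - j`. -/
noncomputable def doubleSum (z : K) (L : ℕ) : K :=
  ∑ i ∈ range (L + 1), ∑ j ∈ range (L + 1), doubleCoeff q L i j * z ^ ((i : ℤ) - j)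

lemma doubleSum_eq_sum_range (z : K) {L N : ℕ} (h : L + 1 ≤ N) :
    doubleSum q z L =
      ∑ i ∈ range N, ∑ j ∈ range N, doubleCoeff q L i j * z ^ ((i : ℤ) - j) := by
  unfold doubleSum
  rw [← sum_product', ← sum_product']
  refine sum_subset (product_subset_product (range_mono h) (range_mono h)) fun p _ hp => ?_
  rw [doubleCoeff_eq_zero, zero_mul]
  simp only [mem_product, mem_range] at hp
  omega

/-- Splitting off the terms with `i = 0` or `j = 0`. -/
lemma doubleSum_eq_boundary_add (z : K) {L N : ℕ} (h : L ≤ N) :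
    doubleSum q z L =
      (∑ i ∈ range N, ∑ j ∈ range N, doubleCoeff q L (i + 1) (j + 1) * z ^ ((i : ℤ) - j)) +
      (∑ i ∈ range (N + 1), doubleCoeff q L i 0 * z ^ (i : ℤ)) +
      (∑ j ∈ range (N + 1), doubleCoeff q L j 0 * z ^ (-(j : ℤ))) - doubleCoeff q L 0 0 := by
  rw [doubleSum_eq_sum_range z (Nat.succ_le_succ h), sum_range_succ' _ N]
  have h₁ : ∀ i : ℕ, ∑ j ∈ range (N + 1),
      doubleCoeff q L (i + 1) j * z ^ (((i + 1 : ℕ) : ℤ) - j) =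
      (∑ j ∈ range N, doubleCoeff q L (i + 1) (j + 1) * z ^ ((i : ℤ) - j)) +
        doubleCoeff q L (i + 1) 0 * z ^ ((i + 1 : ℕ) : ℤ) := by
    intro i
    rw [sum_range_succ']
    simp
  simp only [h₁, sum_add_distrib]
  rw [sum_range_succ' (fun i => doubleCoeff q L i 0 * z ^ (i : ℤ)) N]
  simp only [doubleCoeff_comm L 0, Nat.cast_zero, zero_sub, zpow_zero, mul_one]
  ring

lemma doubleSum_add_two (hP : ∀ n ≤ M, qPoch q q n ≠ 0) (z : K) {L : ℕ} (hL : L + 2 ≤ M) :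
    doubleSum q z (L + 2) =
      (1 - q ^ (L + 2)) * doubleSum q z (L + 1) + q ^ (L + 2) * doubleSum q z L +
        q ^ T (L + 2) * (z ^ ((L + 2 : ℕ) : ℤ) + z ^ (-((L + 2 : ℕ) : ℤ))) := by
  rw [doubleSum_eq_boundary_add z (le_refl (L + 2)),
    doubleSum_eq_boundary_add z (show L + 1 ≤ L + 2 by omega),
    doubleSum_eq_sum_range z (show L + 1 ≤ L + 2 by omega)]
  have h₀ : doubleCoeff q (L + 2) 0 0 = (1 - q ^ (L + 2)) * doubleCoeff q (L + 1) 0 0 := by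
    rw [doubleCoeff_zero_right hP (L := L + 1) hL, if_neg (by omega), add_zero]
  rw [h₀]
  simp only [doubleCoeff_succ_succ hP hL, doubleCoeff_zero_right hP (L := L + 1) hL, add_mul,
    ite_mul, zero_mul, sum_add_distrib, sum_ite_eq', mul_assoc, ← mul_sum]
  simp only [mem_range, Nat.lt_succ_self, if_true]
  ring

lemma doubleSum_zero (z : K) : doubleSum q z 0 = 1 := by
  simp [doubleSum, doubleCoeff, qPoch_zero, T]

lemma doubleSum_one (hq : qPoch q q 1 ≠ 0) (z : K) :
    doubleSum q z 1 = 1 + q * (z + z⁻¹ - 1) := by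
  have h : 1 - q ≠ 0 := by simpa [qPoch] using hq
  simp [doubleSum, doubleCoeff, qPoch, T, sum_range_succ, h]
  ring

lemma sum_range_eq_doubleSum (hP : ∀ n ≤ M, qPoch q q n ≠ 0) {z : K} (hz : z ≠ 0)
    (hz1 : 1 + z ≠ 0) (L : ℕ) (hL : L ≤ M) :
    ∑ n ∈ range (L + 1), q ^ T n * (z ^ (-(n : ℤ)) + z ^ ((n : ℤ) + 1)) / (1 + z) =
      doubleSum q z L := by
  induction L using Nat.twoStepInduction with
  | zero => simp [doubleSum_zero, T, hz1]
  | one =>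
    rw [doubleSum_one (hP 1 hL)]
    simp [sum_range_succ, T, hz1, zpow_add₀ hz]
    field_simp
    ring
  | more L ih ih' =>
    have h := ih' (by omega)
    rw [doubleSum_add_two hP z hL, ← h, ← ih (by omega), sum_range_succ _ (L + 2),
      sum_range_succ _ (L + 1), T_succ (L + 1)]
    simp only [Nat.cast_add, Nat.cast_one, Nat.cast_ofNat, zpow_add₀ hz, neg_add, zpow_neg,
      zpow_natCast, zpow_ofNat]
    field_simp
    ring_nf

lemma sum_range_triple_eq (hP : ∀ n ≤ M, qPoch q q n ≠ 0) {i j : ℕ} (hi : i ≤ M) (hj : j ≤ M)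
    (z : K) :
    ∑ k ∈ range (M + 1), q ^ (T i + T j + T k) * z ^ ((i : ℤ) - (j : ℤ)) * (-1 : K) ^ k *
        qbinom q ((M : ℤ) - i) j * qbinom q ((M : ℤ) - j) k * qbinom q ((M : ℤ) - k) i =
      doubleCoeff q M i j * z ^ ((i : ℤ) - j) := by
  have h : ∀ k ∈ range (M + 1), q ^ (T i + T j + T k) * z ^ ((i : ℤ) - (j : ℤ)) * (-1 : K) ^ k *
      qbinom q ((M : ℤ) - i) j * qbinom q ((M : ℤ) - j) k * qbinom q ((M : ℤ) - k) i =
      q ^ (T i + T j) * z ^ ((i : ℤ) - j) * natQbinom q (M - i) j *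
        ((-1) ^ k * q ^ T k * natQbinom q (M - j) k * natQbinom q (M - k) i) := by
    intro k hk
    rw [qbinom_sub_natCast q j hi, qbinom_sub_natCast q k hj,
      qbinom_sub_natCast q i (Nat.lt_succ_iff.mp (mem_range.mp hk))]
    ring
  rw [sum_congr rfl h, ← mul_sum, ← alternatingSum_eq_sum_range (by omega)]
  by_cases hij : i + j ≤ M
  · rw [alternatingSum_eq hP (by omega) M (by omega) le_rfl, natQbinom, doubleCoeff,
      if_pos (by omega), if_pos hij]
    ring
  · rw [natQbinom_eq_zero q (by omega), doubleCoeff_eq_zero (by omega)]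
    ring

end GaussianBinomial

theorem stmt0 {K : Type*} [Field K] (L : ℕ) (z q : K) (hz : z ≠ 0)
    (hz1 : 1 + z ≠ 0) (hq : ∀ n : ℕ, 1 ≤ n → n ≤ L → q ^ n ≠ 1) :
    ∑ n ∈ Finset.range (L + 1),
        q ^ T n * (z ^ (-(n : ℤ)) + z ^ ((n : ℤ) + 1)) / (1 + z)
      = ∑ i ∈ Finset.range (L + 1), ∑ j ∈ Finset.range (L + 1),
          ∑ k ∈ Finset.range (L + 1),
            q ^ (T i + T j + T k) * z ^ ((i : ℤ) - (j : ℤ)) * (-1 : K) ^ k *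
              qbinom q ((L : ℤ) - i) j * qbinom q ((L : ℤ) - j) k *
              qbinom q ((L : ℤ) - k) i := by
  have hP := qPoch_self_ne_zero hq
  rw [sum_range_eq_doubleSum hP hz hz1 L le_rfl]
  refine sum_congr rfl fun i hi => sum_congr rfl fun j hj => ?_
  exact (sum_range_triple_eq hP (Nat.lt_succ_iff.mp (mem_range.mp hi))
    (Nat.lt_succ_iff.mp (mem_range.mp hj)) z).symm
end

section
/- (Polynomial Lebesgue identity) For every nonnegative integer L, ∑_{i,j≥0} q^{T_i+T_j} (-z^2)^j [L-j choose i]_q [i choose j]_q = ∑_{i,j,k≥0} (-1)^j z^{i+j} q^{T_i+T_j+T_k} [L-i choose j]_q [L-j choose k]_q [L-k choose i]_q, as an identity of polynomials in z and q, where T_n = n(n+1)/2. -/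
open Finset

lemma T_add (a b : ℕ) : T (a + b) = T a + T b + a * b := by
  induction b with
  | zero => simp [T]
  | succ b ih => rw [← add_assoc, T_succ, T_succ, ih]; ring

lemma T_two_mul (n : ℕ) : T (2 * n) = 2 * n ^ 2 + n := by
  unfold T
  rw [show 2 * n * (2 * n + 1) = (2 * n ^ 2 + n) * 2 by ring, Nat.mul_div_cancel _ (by norm_num)]

lemma T_add_self (n : ℕ) : T n + T n = n ^ 2 + n := by
  have h := T_add n n
  rw [← two_mul, T_two_mul] at h
  nlinarith

section Ring

variable {R : Type*} [CommRing R]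

/-- The Gaussian binomial coefficient over a commutative ring, defined by a Pascal recurrence. -/
def gauss (q : R) : ℕ → ℕ → R
  | _, 0 => 1
  | 0, _ + 1 => 0
  | n + 1, k + 1 => gauss q n k + q ^ (k + 1) * gauss q n (k + 1)

/-- The product `(1 - q) (1 - q ^ 2) ⋯ (1 - q ^ n)`. -/
def qFact (q : R) (n : ℕ) : R := ∏ i ∈ range n, (1 - q ^ (i + 1))

/-- The product `(1 + q) (1 + q ^ 2) ⋯ (1 + q ^ n)`. -/
def qFactNeg (q : R) (n : ℕ) : R := ∏ i ∈ range n, (1 + q ^ (i + 1))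

@[simp] lemma gauss_zero_right (q : R) (n : ℕ) : gauss q n 0 = 1 := by cases n <;> rfl

@[simp] lemma gauss_zero_succ (q : R) (k : ℕ) : gauss q 0 (k + 1) = 0 := rfl

lemma gauss_succ_succ (q : R) (n k : ℕ) :
    gauss q (n + 1) (k + 1) = gauss q n k + q ^ (k + 1) * gauss q n (k + 1) := rfl

lemma gauss_eq_zero_of_lt (q : R) : ∀ {n k : ℕ}, n < k → gauss q n k = 0
  | _, 0, h => by omega
  | 0, _ + 1, _ => rfl
  | n + 1, k + 1, h => by
    rw [gauss_succ_succ, gauss_eq_zero_of_lt q (show n < k by omega),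
      gauss_eq_zero_of_lt q (show n < k + 1 by omega)]
    simp

lemma map_gauss {S : Type*} [CommRing S] (f : R →+* S) (q : R) :
    ∀ n k : ℕ, f (gauss q n k) = gauss (f q) n k
  | _, 0 => by simp
  | 0, _ + 1 => by simp
  | n + 1, k + 1 => by
    simp [gauss_succ_succ, map_gauss f q n k, map_gauss f q n (k + 1)]

@[simp] lemma qFact_zero (q : R) : qFact q 0 = 1 := rfl

lemma qFact_succ (q : R) (n : ℕ) : qFact q (n + 1) = qFact q n * (1 - q ^ (n + 1)) :=
  prod_range_succ _ _

@[simp] lemma qFactNeg_zero (q : R) : qFactNeg q 0 = 1 := rfl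

lemma qFactNeg_succ (q : R) (n : ℕ) :
    qFactNeg q (n + 1) = qFactNeg q n * (1 + q ^ (n + 1)) :=
  prod_range_succ _ _

lemma qFact_sq (q : R) (n : ℕ) : qFact (q ^ 2) n = qFact q n * qFactNeg q n := by
  rw [qFact, qFact, qFactNeg, ← prod_mul_distrib]
  exact prod_congr rfl fun i _ => by ring

lemma gauss_mul_qFact (q : R) : ∀ a b : ℕ,
    gauss q (a + b) a * (qFact q a * qFact q b) = qFact q (a + b)
  | 0, b => by simp
  | a + 1, 0 => by
    have h := gauss_mul_qFact q a 0
    simp only [add_zero, qFact_zero, mul_one] at h ⊢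
    rw [gauss_succ_succ, gauss_eq_zero_of_lt q (Nat.lt_succ_self a), qFact_succ]
    linear_combination (1 - q ^ (a + 1)) * h
  | a + 1, b + 1 => by
    have h₁ := gauss_mul_qFact q a (b + 1)
    have h₂ := gauss_mul_qFact q (a + 1) b
    rw [show a + 1 + b = a + b + 1 by ring] at h₂
    rw [show a + (b + 1) = a + b + 1 by ring] at h₁
    rw [show a + 1 + (b + 1) = a + b + 1 + 1 by ring, gauss_succ_succ, qFact_succ q (a + b + 1)]
    rw [qFact_succ] at h₁ h₂ ⊢
    rw [qFact_succ q b]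
    rw [qFact_succ q (a + b)] at h₁ h₂ ⊢
    linear_combination (1 - q ^ (a + 1)) * h₁ + q ^ (a + 1) * (1 - q ^ (b + 1)) * h₂

/-- The `q`-Chu–Vandermonde identity. -/
lemma gauss_add (q : R) (m n p : ℕ) :
    gauss q (m + n) p =
      ∑ x ∈ antidiagonal p, gauss q m x.1 * gauss q n x.2 * q ^ ((m - x.1) * x.2) := by
  induction m generalizing p with
  | zero =>
    cases p with
    | zero => simp
    | succ p => simp [Nat.sum_antidiagonal_succ]
  | succ m ih =>
    cases p with
    | zero => simp
    | succ p =>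
      rw [show m + 1 + n = m + n + 1 by ring, gauss_succ_succ, ih, ih,
        Nat.sum_antidiagonal_succ, Nat.sum_antidiagonal_succ, mul_add, mul_sum]
      simp only [gauss_zero_right, gauss_succ_succ, Nat.succ_sub_succ, add_mul, sum_add_distrib]
      rw [add_left_comm]
      congr 1
      · simp only [tsub_zero]
        ring
      congr 1
      refine sum_congr rfl fun x hx => ?_
      rw [HasAntidiagonal.mem_antidiagonal] at hx
      rcases lt_or_ge m (x.1 + 1) with h | h
      · simp [gauss_eq_zero_of_lt q h]
      · obtain ⟨d, rfl⟩ := Nat.exists_eq_add_of_le h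
        rw [← hx, show x.1 + 1 + d - x.1 = d + 1 by omega, Nat.add_sub_cancel_left]
        ring

/-- The `q`-binomial theorem. -/
lemma sum_pow_T_mul_gauss (q x : R) (n : ℕ) :
    ∑ k ∈ range (n + 1), x ^ k * q ^ T k * gauss q n k = ∏ i ∈ range n, (1 + x * q ^ (i + 1)) := by
  induction n generalizing x with
  | zero => simp [T]
  | succ n ih =>
    rw [prod_range_succ', sum_range_succ']
    simp only [gauss_succ_succ, mul_add, sum_add_distrib]
    have h₁ : ∑ k ∈ range (n + 1), x ^ (k + 1) * q ^ T (k + 1) * gauss q n k =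
        x * q * ∏ i ∈ range n, (1 + x * q * q ^ (i + 1)) := by
      rw [← ih, mul_sum]
      exact sum_congr rfl fun k _ => by rw [T_succ]; ring
    have h₂ : ∑ k ∈ range (n + 1), x ^ (k + 1) * q ^ T (k + 1) * (q ^ (k + 1) * gauss q n (k + 1))
        + x ^ 0 * q ^ T 0 * gauss q (n + 1) 0 = ∏ i ∈ range n, (1 + x * q * q ^ (i + 1)) := by
      rw [← ih, sum_range_succ, gauss_eq_zero_of_lt q (Nat.lt_succ_self n), sum_range_succ']
      simp only [mul_zero, add_zero, gauss_zero_right]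
      congr 1
      · exact sum_congr rfl fun k _ => by ring
      · simp
    rw [add_assoc, h₁, h₂]
    simp only [pow_succ', pow_zero, mul_one, mul_assoc]
    ring

lemma sum_pow_T_mul_gauss_eq_qFactNeg (q : R) {n N : ℕ} (h : n ≤ N) :
    ∑ k ∈ range (N + 1), q ^ T k * gauss q n k = qFactNeg q n := by
  have hs := sum_pow_T_mul_gauss q 1 n
  simp only [one_pow, one_mul] at hs
  rw [qFactNeg, ← hs]
  refine (sum_subset (range_mono (by omega)) fun k _ hk => ?_).symm
  rw [mem_range, not_lt] at hk
  rw [gauss_eq_zero_of_lt q (by omega), mul_zero]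

lemma gauss_mul_gauss_mul_qFact (q : R) (a b c : ℕ) :
    gauss q (a + (b + c)) a * gauss q (b + c) b * (qFact q a * qFact q b * qFact q c) =
      qFact q (a + (b + c)) := by
  rw [← gauss_mul_qFact q a (b + c), ← gauss_mul_qFact q b c]
  ring

@[simp] lemma gauss_self (q : R) (n : ℕ) : gauss q n n = 1 := by
  induction n with
  | zero => simp
  | succ n ih => rw [gauss_succ_succ, ih, gauss_eq_zero_of_lt q (Nat.lt_succ_self n)]; ring

lemma sum_antidiagonal_gauss_succ (q : R) (m : ℕ) (f : ℕ → ℕ → R) :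
    ∑ x ∈ antidiagonal (m + 1), gauss q (m + 1) x.1 * f x.1 x.2 =
      ∑ x ∈ antidiagonal m,
        gauss q m x.1 * (q ^ x.1 * f x.1 (x.2 + 1) + f (x.1 + 1) x.2) := by
  have h : ∑ x ∈ antidiagonal (m + 1), q ^ x.1 * gauss q m x.1 * f x.1 x.2 =
      ∑ x ∈ antidiagonal m, q ^ x.1 * gauss q m x.1 * f x.1 (x.2 + 1) := by
    rw [Nat.sum_antidiagonal_succ', gauss_eq_zero_of_lt q (Nat.lt_succ_self m)]
    simp
  rw [Nat.sum_antidiagonal_succ] at h ⊢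
  simp only [gauss_zero_right, pow_zero, one_mul] at h ⊢
  simp only [gauss_succ_succ, mul_add, add_mul, sum_add_distrib]
  have h' : ∑ x ∈ antidiagonal m, gauss q m x.1 * (q ^ x.1 * f x.1 (x.2 + 1)) =
      ∑ x ∈ antidiagonal m, q ^ x.1 * gauss q m x.1 * f x.1 (x.2 + 1) :=
    sum_congr rfl fun x _ => by ring
  rw [h', ← h]
  ring

/-- Trim both ends of a sum over an antidiagonal. -/
lemma sum_antidiagonal_add_two_mul (n u : ℕ) (f : ℕ → ℕ → R)
    (hf : ∀ i j, i < u ∨ j < u → f i j = 0) :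
    ∑ x ∈ antidiagonal (n + 2 * u), f x.1 x.2 =
      ∑ x ∈ antidiagonal n, f (u + x.1) (u + x.2) := by
  induction u generalizing f with
  | zero => simp
  | succ u ih =>
    rw [show n + 2 * (u + 1) = n + 2 * u + 1 + 1 by ring, Nat.sum_antidiagonal_succ,
      Nat.sum_antidiagonal_succ', hf 0 _ (by simp), hf _ 0 (by simp), zero_add, zero_add]
    rw [ih (fun i j => f (i + 1) (j + 1)) fun i j h => hf _ _ (by omega)]
    exact sum_congr rfl fun x _ => by rw [add_right_comm u x.1, add_right_comm u x.2]

lemma sq_pow_succ_ne_one {q : R} (hq : ∀ n : ℕ, q ^ (n + 1) ≠ 1) (n : ℕ) :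
    (q ^ 2) ^ (n + 1) ≠ 1 := by
  rw [← pow_mul, show 2 * (n + 1) = 2 * n + 1 + 1 by ring]
  exact hq _

end Ring

lemma sum_range_ite_even {R : Type*} [AddCommMonoid R] (L : ℕ) (g : ℕ → R) :
    ∑ n ∈ range (L + 1), (if Even n then g (n / 2) else 0) =
      ∑ j ∈ range (L + 1), if 2 * j ≤ L then g j else 0 := by
  rw [← sum_filter, ← sum_filter]
  refine sum_nbij' (· / 2) (2 * ·) ?_ ?_ ?_ ?_ fun _ _ => rfl
  all_goals
    intro n hn
    simp only [mem_filter, mem_range, Nat.even_iff] at hn ⊢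
    omega

section Domain

variable {R : Type*} [CommRing R] [IsDomain R] {q : R}

lemma qFact_ne_zero (hq : ∀ n : ℕ, q ^ (n + 1) ≠ 1) (n : ℕ) : qFact q n ≠ 0 :=
  prod_ne_zero_iff.2 fun i _ => sub_ne_zero.2 (hq i).symm

lemma qFactNeg_ne_zero (hq : ∀ n : ℕ, q ^ (n + 1) ≠ 1) (n : ℕ) : qFactNeg q n ≠ 0 := by
  have h := qFact_ne_zero (sq_pow_succ_ne_one hq) n
  rw [qFact_sq] at h
  exact right_ne_zero_of_mul h

lemma gauss_symm (hq : ∀ n : ℕ, q ^ (n + 1) ≠ 1) (a b : ℕ) :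
    gauss q (a + b) a = gauss q (a + b) b := by
  refine mul_right_cancel₀ (mul_ne_zero (qFact_ne_zero hq a) (qFact_ne_zero hq b)) ?_
  rw [gauss_mul_qFact, add_comm a b, mul_comm (qFact q a), gauss_mul_qFact]

lemma gauss_add_succ_succ (hq : ∀ n : ℕ, q ^ (n + 1) ≠ 1) (E j : ℕ) :
    gauss q (E + 1 + (j + 1)) (j + 1) =
      gauss q (E + (j + 1)) (j + 1) + q ^ (E + 1) * gauss q (E + 1 + j) j := by
  rw [← gauss_symm hq, ← gauss_symm hq, ← gauss_symm hq, ← add_assoc, gauss_succ_succ]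
  ring_nf

lemma sum_antidiagonal_gauss_succ' (hq : ∀ n : ℕ, q ^ (n + 1) ≠ 1) (m : ℕ) (f : ℕ → ℕ → R) :
    ∑ x ∈ antidiagonal (m + 1), gauss q (m + 1) x.1 * f x.1 x.2 =
      ∑ x ∈ antidiagonal m,
        gauss q m x.1 * (f x.1 (x.2 + 1) + q ^ x.2 * f (x.1 + 1) x.2) := by
  have hs : ∀ {n : ℕ}, ∀ x ∈ antidiagonal n, gauss q n x.2 = gauss q n x.1 := by
    intro n x hx
    rw [← HasAntidiagonal.mem_antidiagonal.1 hx, gauss_symm hq]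
  have h := sum_antidiagonal_gauss_succ q m fun i j => f j i
  rw [← Nat.sum_antidiagonal_swap, ← Nat.sum_antidiagonal_swap (n := m)] at h
  simp only [Prod.fst_swap, Prod.snd_swap] at h
  rw [sum_congr rfl fun x hx => by rw [hs x hx], sum_congr (s₁ := antidiagonal m) rfl
    fun x hx => by rw [hs x hx]] at h
  rw [h]
  exact sum_congr rfl fun x _ => by rw [add_comm (q ^ x.2 * _)]

lemma gauss_mul_gauss_comm (hq : ∀ n : ℕ, q ^ (n + 1) ≠ 1) (A k r : ℕ) :
    gauss q A k * gauss q (A - k) r = gauss q A r * gauss q (A - r) k := by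
  by_cases h : k + r ≤ A
  · obtain ⟨c, rfl⟩ := Nat.exists_eq_add_of_le h
    refine mul_right_cancel₀ (mul_ne_zero (mul_ne_zero (qFact_ne_zero hq k)
      (qFact_ne_zero hq r)) (qFact_ne_zero hq c)) ?_
    have h₁ := gauss_mul_gauss_mul_qFact q k r c
    have h₂ := gauss_mul_gauss_mul_qFact q r k c
    rw [show k + r + c - k = r + c by omega, show k + r + c - r = k + c by omega]
    rw [← add_assoc] at h₁ h₂
    rw [add_comm r k] at h₂
    rw [h₁, ← h₂]
    ring
  · have h₀ : ∀ a b : ℕ, ¬ a + b ≤ A → gauss q A a * gauss q (A - a) b = 0 := by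
      intro a b hab
      rcases lt_or_ge A a with ha | ha
      · rw [gauss_eq_zero_of_lt q ha, zero_mul]
      · rw [gauss_eq_zero_of_lt q (show A - a < b by omega), mul_zero]
    rw [h₀ k r h, h₀ r k (by omega)]

lemma sum_T_mul_gauss_mul_gauss (hq : ∀ n : ℕ, q ^ (n + 1) ≠ 1) {D i N : ℕ} (j : ℕ)
    (h : D + i ≤ N) :
    ∑ k ∈ range (N + 1), q ^ T k * gauss q (D + i) k * gauss q (D + i + j - k) i =
      ∑ x ∈ antidiagonal i, gauss q j x.1 * q ^ ((j - x.1) * x.2) * gauss q (D + i) (D + x.1) *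
        qFactNeg q (D + x.1) := by
  have h₁ : ∀ k ∈ range (N + 1), q ^ T k * gauss q (D + i) k * gauss q (D + i + j - k) i =
      ∑ x ∈ antidiagonal i, gauss q j x.1 * q ^ ((j - x.1) * x.2) * gauss q (D + i) (D + x.1) *
        (q ^ T k * gauss q (D + x.1) k) := by
    intro k _
    have h₂ : gauss q (D + i) k * gauss q (D + i + j - k) i =
        gauss q (D + i) k * gauss q (j + (D + i - k)) i := by
      rcases lt_or_ge (D + i) k with hk | hk
      · simp [gauss_eq_zero_of_lt q hk]
      · rw [show D + i + j - k = j + (D + i - k) by omega]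
    rw [mul_assoc, h₂, gauss_add q j, mul_sum, mul_sum]
    refine sum_congr rfl fun x hx => ?_
    have hx := HasAntidiagonal.mem_antidiagonal.1 hx
    have h₃ := gauss_mul_gauss_comm hq (D + i) k x.2
    have h₄ := gauss_symm hq (D + x.1) x.2
    rw [show D + x.1 + x.2 = D + i by omega] at h₄
    rw [show D + i - x.2 = D + x.1 by omega, ← h₄] at h₃
    linear_combination q ^ T k * gauss q j x.1 * q ^ ((j - x.1) * x.2) * h₃
  rw [sum_congr rfl h₁, sum_comm]
  refine sum_congr rfl fun x hx => ?_
  have hx := HasAntidiagonal.mem_antidiagonal.1 hx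
  rw [← mul_sum, sum_pow_T_mul_gauss_eq_qFactNeg q (by omega)]

lemma gauss_mul_qFactNeg_mul_gauss_sq (hq : ∀ n : ℕ, q ^ (n + 1) ≠ 1) (D u v : ℕ) :
    gauss q (D + u) u * qFactNeg q (D + u) * gauss (q ^ 2) (D + u + v) v =
      gauss (q ^ 2) (D + (u + v)) (u + v) * gauss (q ^ 2) (u + v) v *
        (qFactNeg q D * qFactNeg q u) := by
  have hq' := sq_pow_succ_ne_one hq
  refine mul_right_cancel₀ (mul_ne_zero (mul_ne_zero (qFact_ne_zero hq D) (qFact_ne_zero hq u))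
    (qFact_ne_zero hq' v)) ?_
  have h₁ := gauss_mul_qFact q D u
  have h₂ := gauss_mul_qFact (q ^ 2) (D + u) v
  have h₃ := gauss_mul_gauss_mul_qFact (q ^ 2) D u v
  rw [gauss_symm hq] at h₁
  rw [gauss_symm hq', qFact_sq q (D + u)] at h₂
  rw [gauss_symm hq', gauss_symm hq', qFact_sq q D, qFact_sq q u] at h₃
  rw [← add_assoc] at h₃ ⊢
  linear_combination qFactNeg q (D + u) * gauss (q ^ 2) (D + u + v) v * qFact (q ^ 2) v * h₁
    + h₂ - h₃

lemma sum_antidiagonal_gauss_sq (hq : ∀ n : ℕ, q ^ (n + 1) ≠ 1) (m : ℕ) :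
    ∑ x ∈ antidiagonal m,
        gauss (q ^ 2) m x.1 * ((-1) ^ x.1 * q ^ (x.1 * x.1) * qFactNeg q x.2) = 1 ∧
      ∑ x ∈ antidiagonal m,
        gauss (q ^ 2) m x.1 * ((-1) ^ x.1 * q ^ (x.1 * (x.1 - 1)) * qFactNeg q x.2) = q ^ m := by
  have hq' := sq_pow_succ_ne_one hq
  induction m with
  | zero => simp
  | succ m ih =>
    obtain ⟨hP, hQ⟩ := ih
    have hv : ∀ v : ℕ, q ^ (v * v) = q ^ v * q ^ (v * (v - 1)) := by
      intro v
      cases v with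
      | zero => simp
      | succ v => rw [Nat.add_sub_cancel]; ring
    constructor
    · rw [sum_antidiagonal_gauss_succ' hq' m
        fun i j => (-1) ^ i * q ^ (i * i) * qFactNeg q j]
      calc _ = ∑ x ∈ antidiagonal m,
          ((1 - q ^ (2 * m + 1)) *
            (gauss (q ^ 2) m x.1 * ((-1) ^ x.1 * q ^ (x.1 * x.1) * qFactNeg q x.2)) +
          q ^ (m + 1) *
            (gauss (q ^ 2) m x.1 * ((-1) ^ x.1 * q ^ (x.1 * (x.1 - 1)) * qFactNeg q x.2))) := by
            refine sum_congr rfl fun x hx => ?_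
            rw [← HasAntidiagonal.mem_antidiagonal.1 hx, qFactNeg_succ]
            linear_combination gauss (q ^ 2) (x.1 + x.2) x.1 * (-1) ^ x.1 * qFactNeg q x.2 *
              q ^ (x.2 + 1) * hv x.1
        _ = 1 := by
            rw [sum_add_distrib, ← mul_sum, ← mul_sum, hP, hQ]
            ring
    · rw [sum_antidiagonal_gauss_succ (q ^ 2) m
        fun i j => (-1) ^ i * q ^ (i * (i - 1)) * qFactNeg q j]
      refine Eq.trans ?_ (mul_one (q ^ (m + 1)))
      conv_rhs => rw [← hP, mul_sum]
      refine sum_congr rfl fun x hx => ?_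
      rw [← HasAntidiagonal.mem_antidiagonal.1 hx, qFactNeg_succ, Nat.add_sub_cancel]
      linear_combination -gauss (q ^ 2) (x.1 + x.2) x.1 * (-1) ^ x.1 * qFactNeg q x.2 *
        q ^ x.1 * (1 + q ^ (x.2 + 1)) * hv x.1

open PowerSeries in
/-- The coefficientwise form of `1 / ((x; q)_{E+1} (-x; q)_{E+1}) = 1 / (x²; q²)_{E+1}`. -/
lemma sum_antidiagonal_neg_one_pow_mul_gauss_mul_gauss (hq : ∀ n : ℕ, q ^ (n + 1) ≠ 1) (E n : ℕ) :
    ∑ x ∈ antidiagonal n, (-1) ^ x.2 * gauss q (E + x.1) x.1 * gauss q (E + x.2) x.2 =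
      if Even n then gauss (q ^ 2) (E + n / 2) (n / 2) else 0 := by
  have hq' := sq_pow_succ_ne_one hq
  let G : ℕ → R⟦X⟧ := fun E => mk fun j => gauss q (E + j) j
  let K : ℕ → R⟦X⟧ := fun E => mk fun n => if Even n then gauss (q ^ 2) (E + n / 2) (n / 2) else 0
  let H : ℕ → R⟦X⟧ := fun E => mk fun j => (-1) ^ j * gauss q (E + j) j
  have hG : ∀ E, (1 - C (q ^ (E + 1)) * X) * G (E + 1) = G E := by
    intro E
    ext n
    rw [sub_mul, one_mul, mul_assoc, map_sub, coeff_C_mul]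
    cases n with
    | zero => simp [G]
    | succ n =>
      rw [coeff_succ_X_mul]
      simp only [G, coeff_mk]
      rw [gauss_add_succ_succ hq]
      ring
  have hH : ∀ E, (1 + C (q ^ (E + 1)) * X) * H (E + 1) = H E := by
    intro E
    ext n
    rw [add_mul, one_mul, mul_assoc, map_add, coeff_C_mul]
    cases n with
    | zero => simp [H]
    | succ n =>
      rw [coeff_succ_X_mul]
      simp only [H, coeff_mk]
      rw [gauss_add_succ_succ hq]
      ring
  have hK : ∀ E, (1 - C (q ^ (E + 1)) * X) * (1 + C (q ^ (E + 1)) * X) * K (E + 1) = K E := by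
    intro E
    have h : (1 - C (q ^ (E + 1)) * X) * (1 + C (q ^ (E + 1)) * X) * K (E + 1) =
        K (E + 1) - C ((q ^ 2) ^ (E + 1)) * (X * (X * K (E + 1))) := by
      simp only [map_pow]
      ring
    rw [h]
    ext n
    rw [map_sub, coeff_C_mul]
    match n with
    | 0 => simp [K]
    | 1 => simp [K, coeff_succ_X_mul 0]
    | n + 2 =>
      rw [coeff_succ_X_mul, coeff_succ_X_mul]
      simp only [K, coeff_mk, show Even (n + 2) ↔ Even n by simp [parity_simps],
        Nat.add_div_right n two_pos]
      split_ifs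
      · rw [gauss_add_succ_succ hq']
        ring
      · simp
  have hGHK : ∀ E, G E * H E = K E := by
    intro E
    induction E with
    | zero =>
      ext n
      simp only [G, H, K, coeff_mul, coeff_mk, zero_add, gauss_self, one_mul, mul_one]
      rw [← Nat.sum_antidiagonal_swap, Nat.sum_antidiagonal_eq_sum_range_succ_mk]
      simp only [Prod.snd_swap, neg_one_geom_sum, Nat.even_add_one, Nat.succ_eq_add_one, ite_not]
    | succ E ih =>
      have hne : (1 - C (q ^ (E + 1)) * X) * (1 + C (q ^ (E + 1)) * X) ≠ (0 : R⟦X⟧) := by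
        intro h
        simpa using congrArg (coeff 0) h
      refine mul_left_cancel₀ hne ?_
      rw [hK, ← ih, ← hG E, ← hH E]
      ring
  have h := congrArg (coeff n) (hGHK E)
  simp only [G, H, K, coeff_mul, coeff_mk] at h
  rw [← h]
  exact sum_congr rfl fun x _ => by ring

lemma sum_antidiagonal_shifted (hq : ∀ n : ℕ, q ^ (n + 1) ≠ 1) (D u n : ℕ) :
    ∑ x ∈ antidiagonal (n + 2 * u), (-1) ^ x.2 * q ^ (T x.1 + T x.2) * gauss q (D + x.2) x.2 *
        (gauss q x.2 u * q ^ ((x.2 - u) * (x.1 - u)) * gauss q (D + x.1) (D + u) *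
          qFactNeg q (D + u)) =
      (-1) ^ u * q ^ (T n + u * n + (u ^ 2 + u)) * (gauss q (D + u) u * qFactNeg q (D + u)) *
        if Even n then gauss (q ^ 2) (D + u + n / 2) (n / 2) else 0 := by
  rw [sum_antidiagonal_add_two_mul n u fun i j => (-1) ^ j * q ^ (T i + T j) *
      gauss q (D + j) j * (gauss q j u * q ^ ((j - u) * (i - u)) * gauss q (D + i) (D + u) *
      qFactNeg q (D + u)), ← sum_antidiagonal_neg_one_pow_mul_gauss_mul_gauss hq, mul_sum]
  · refine sum_congr rfl fun x hx => ?_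
    rw [← HasAntidiagonal.mem_antidiagonal.1 hx]
    obtain ⟨i, j⟩ := x
    simp only [Nat.add_sub_cancel_left]
    have h₁ : gauss q (D + (u + j)) (u + j) * gauss q (u + j) u =
        gauss q (D + u) u * gauss q (D + u + j) j := by
      have h := gauss_mul_gauss_comm hq (D + u + j) j D
      rw [show D + u + j - j = D + u by omega, show D + u + j - D = u + j by omega,
        gauss_symm hq D u, ← gauss_symm hq u j, add_assoc, gauss_symm hq D (u + j)] at h
      rw [add_assoc, ← h, mul_comm]
    have h₂ : gauss q (D + (u + i)) (D + u) = gauss q (D + u + i) i := by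
      rw [← add_assoc, gauss_symm hq]
    have h₃ : T (u + i) + T (u + j) + j * i = T (i + j) + u * (i + j) + (u ^ 2 + u) := by
      rw [T_add, T_add, T_add, ← T_add_self u]
      ring
    rw [h₂, ← h₃, pow_add _ _ (j * i), pow_add (-1 : R)]
    linear_combination (-1) ^ u * (-1) ^ j * q ^ (T (u + i) + T (u + j)) * q ^ (j * i) *
      gauss q (D + u + i) i * qFactNeg q (D + u) * h₁
  · rintro i j (h | h)
    · rw [gauss_eq_zero_of_lt q (show D + i < D + u by omega)]
      ring
    · rw [gauss_eq_zero_of_lt q h]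
      ring

lemma sum_range_gauss_sq (hq : ∀ n : ℕ, q ^ (n + 1) ≠ 1) (D m : ℕ) :
    ∑ u ∈ range (m + 1), (-1) ^ u *
        q ^ (T (2 * (m - u)) + u * (2 * (m - u)) + (u ^ 2 + u)) *
          (gauss q (D + u) u * qFactNeg q (D + u)) * gauss (q ^ 2) (D + u + (m - u)) (m - u) =
      (-1) ^ m * q ^ (T m + T m) * gauss (q ^ 2) (D + m) m * qFactNeg q D := by
  have h := (sum_antidiagonal_gauss_sq hq m).1
  rw [← Nat.sum_antidiagonal_swap, Nat.sum_antidiagonal_eq_sum_range_succ_mk] at h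
  refine Eq.trans ?_ ((congrArg (HMul.hMul _) h).trans (mul_one _))
  rw [mul_sum]
  refine sum_congr rfl fun u hu => ?_
  obtain ⟨v, rfl⟩ := Nat.exists_eq_add_of_le (Nat.lt_succ_iff.1 (mem_range.1 hu))
  simp only [Nat.add_sub_cancel_left, Prod.fst_swap, Prod.snd_swap]
  rw [mul_assoc, gauss_mul_qFactNeg_mul_gauss_sq hq, T_add_self,
    T_two_mul,
    show 2 * v ^ 2 + v + u * (2 * v) + (u ^ 2 + u) = (u + v) ^ 2 + (u + v) + v * v by ring,
    pow_add q _ (v * v), pow_add (-1 : R)]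
  have hv : (-1 : R) ^ v * (-1) ^ v = 1 := by rw [← mul_pow]; simp
  linear_combination -(-1) ^ u * q ^ ((u + v) ^ 2 + (u + v)) * q ^ (v * v) *
    gauss (q ^ 2) (D + (u + v)) (u + v) * gauss (q ^ 2) (u + v) v * qFactNeg q D * qFactNeg q u *
    hv

lemma sum_antidiagonal_triple (hq : ∀ n : ℕ, q ^ (n + 1) ≠ 1) (D n N : ℕ) (hN : D + n ≤ N) :
    ∑ x ∈ antidiagonal n, (-1) ^ x.2 * q ^ (T x.1 + T x.2) * gauss q (D + x.2) x.2 *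
        ∑ k ∈ range (N + 1),
          q ^ T k * gauss q (D + x.1) k * gauss q (D + x.1 + x.2 - k) x.1 =
      if Even n then (-1) ^ (n / 2) * q ^ (T (n / 2) + T (n / 2)) *
        gauss (q ^ 2) (D + n / 2) (n / 2) * qFactNeg q D else 0 := by
  have h₁ : ∀ x ∈ antidiagonal n, (-1) ^ x.2 * q ^ (T x.1 + T x.2) * gauss q (D + x.2) x.2 *
        ∑ k ∈ range (N + 1),
          q ^ T k * gauss q (D + x.1) k * gauss q (D + x.1 + x.2 - k) x.1 =
      ∑ u ∈ range (n + 1), (-1) ^ x.2 * q ^ (T x.1 + T x.2) * gauss q (D + x.2) x.2 *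
        (gauss q x.2 u * q ^ ((x.2 - u) * (x.1 - u)) * gauss q (D + x.1) (D + u) *
          qFactNeg q (D + u)) := by
    intro x hx
    have hx := HasAntidiagonal.mem_antidiagonal.1 hx
    rw [sum_T_mul_gauss_mul_gauss hq _ (by omega),
      Nat.sum_antidiagonal_eq_sum_range_succ_mk, ← mul_sum]
    congr 1
    refine sum_subset (range_mono (by omega)) fun u _ hu => ?_
    rw [mem_range, not_lt] at hu
    rw [gauss_eq_zero_of_lt q (show D + x.1 < D + u by omega)]
    ring
  rw [sum_congr rfl h₁, sum_comm]
  have h₂ : ∀ u, n < 2 * u → ∑ x ∈ antidiagonal n, (-1) ^ x.2 * q ^ (T x.1 + T x.2) *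
      gauss q (D + x.2) x.2 * (gauss q x.2 u * q ^ ((x.2 - u) * (x.1 - u)) *
        gauss q (D + x.1) (D + u) * qFactNeg q (D + u)) = 0 := by
    intro u hu
    refine sum_eq_zero fun x hx => ?_
    have hx := HasAntidiagonal.mem_antidiagonal.1 hx
    rcases (show x.1 < u ∨ x.2 < u by omega) with h | h
    · rw [gauss_eq_zero_of_lt q (show D + x.1 < D + u by omega)]
      ring
    · rw [gauss_eq_zero_of_lt q h]
      ring
  split_ifs with hn
  · obtain ⟨m, rfl⟩ := hn.two_dvd
    rw [Nat.mul_div_cancel_left m two_pos, ← sum_range_gauss_sq hq]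
    rw [← sum_subset (range_mono (show m + 1 ≤ 2 * m + 1 by omega)) fun u _ hu =>
      h₂ u (by rw [mem_range, not_lt] at hu; omega)]
    refine sum_congr rfl fun u hu => ?_
    have hu := mem_range.1 hu
    have h := sum_antidiagonal_shifted hq D u (2 * (m - u))
    rw [show 2 * (m - u) + 2 * u = 2 * m by omega, if_pos (even_two_mul _),
      Nat.mul_div_cancel_left _ two_pos] at h
    exact h
  · refine sum_eq_zero fun u _ => ?_
    rcases lt_or_ge n (2 * u) with h | h
    · exact h₂ u h
    · have h' := sum_antidiagonal_shifted hq D u (n - 2 * u)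
      rw [Nat.sub_add_cancel h, if_neg (by simp [Nat.even_sub h, hn]), mul_zero] at h'
      exact h'

lemma sum_T_mul_gauss_mul_gauss_eq_gauss_sq (hq : ∀ n : ℕ, q ^ (n + 1) ≠ 1) {D j N : ℕ}
    (hN : D + j ≤ N) :
    ∑ i ∈ range (N + 1), q ^ T i * gauss q (D + j) i * gauss q i j =
      q ^ T j * gauss (q ^ 2) (D + j) j * qFactNeg q D := by
  have h₁ : ∑ i ∈ range (N + 1), q ^ T i * gauss q (D + j) i * gauss q i j =
      ∑ r ∈ range (D + 1), q ^ T (j + r) * gauss q (D + j) (j + r) * gauss q (j + r) j := by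
    have h := sum_range_add (fun i => q ^ T i * gauss q (D + j) i * gauss q i j) j (D + 1)
    have h₀ : ∑ i ∈ range j, q ^ T i * gauss q (D + j) i * gauss q i j = 0 :=
      sum_eq_zero fun i hi => by rw [gauss_eq_zero_of_lt q (mem_range.1 hi), mul_zero]
    rw [h₀, zero_add] at h
    rw [← h]
    refine (sum_subset (range_mono (by omega)) fun i _ hi => ?_).symm
    rw [mem_range, not_lt] at hi
    rw [gauss_eq_zero_of_lt q (show D + j < i by omega)]
    ring
  have h₂ : ∀ r ∈ range (D + 1),
      q ^ T (j + r) * gauss q (D + j) (j + r) * gauss q (j + r) j =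
        q ^ T j * gauss q (D + j) j * ((q ^ j) ^ r * q ^ T r * gauss q D r) := by
    intro r hr
    obtain ⟨s, rfl⟩ := Nat.exists_eq_add_of_le (Nat.lt_succ_iff.1 (mem_range.1 hr))
    have h := gauss_mul_gauss_comm hq (r + s + j) s j
    rw [show r + s + j - s = j + r by omega, show r + s + j - j = r + s by omega,
      ← gauss_symm hq r s, show r + s + j = j + r + s by ring, ← gauss_symm hq (j + r) s] at h
    rw [show r + s + j = j + r + s by ring, T_add]
    linear_combination q ^ (T j + T r + j * r) * h
  rw [h₁, sum_congr rfl h₂, ← mul_sum, sum_pow_T_mul_gauss]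
  refine mul_right_cancel₀ (qFactNeg_ne_zero hq j) ?_
  have h₃ : qFactNeg q (D + j) = qFactNeg q j * ∏ i ∈ range D, (1 + q ^ j * q ^ (i + 1)) := by
    rw [add_comm, qFactNeg, prod_range_add, qFactNeg]
    exact congrArg _ (prod_congr rfl fun i _ => by ring)
  have h₄ := gauss_mul_qFactNeg_mul_gauss_sq hq D j 0
  simp only [gauss_zero_right, add_zero, mul_one, h₃] at h₄
  linear_combination q ^ T j * h₄

/-- The polynomial Lebesgue identity when `q` is not a root of unity. -/
theorem lebesgue_gauss_of_isDomain (hq : ∀ n : ℕ, q ^ (n + 1) ≠ 1) (L : ℕ) (z : R) :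
    ∑ i ∈ range (L + 1), ∑ j ∈ range (L + 1),
        q ^ (T i + T j) * (-z ^ 2) ^ j * gauss q (L - j) i * gauss q i j =
      ∑ i ∈ range (L + 1), ∑ j ∈ range (L + 1), ∑ k ∈ range (L + 1),
        (-1) ^ j * z ^ (i + j) * q ^ (T i + T j + T k) *
          gauss q (L - i) j * gauss q (L - j) k * gauss q (L - k) i := by
  let F : ℕ → ℕ → R := fun i j => z ^ (i + j) * ((-1) ^ j * q ^ (T i + T j) * gauss q (L - i) j *
    ∑ k ∈ range (L + 1), q ^ T k * gauss q (L - j) k * gauss q (L - k) i)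
  have hF : ∀ i ∈ range (L + 1), ∑ j ∈ range (L + 1), ∑ k ∈ range (L + 1),
      (-1) ^ j * z ^ (i + j) * q ^ (T i + T j + T k) *
        gauss q (L - i) j * gauss q (L - j) k * gauss q (L - k) i =
      ∑ j ∈ range (L + 1 - i), F i j := by
    intro i hi
    have hi := mem_range.1 hi
    rw [sum_subset (range_mono (Nat.sub_le (L + 1) i)) fun j _ hj => ?_]
    · refine sum_congr rfl fun j _ => ?_
      simp only [F, mul_sum]
      exact sum_congr rfl fun k _ => by ring
    · rw [mem_range, not_lt] at hj
      simp only [F]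
      rw [gauss_eq_zero_of_lt q (show L - i < j by omega)]
      ring
  rw [sum_congr rfl hF, ← sum_range_diag_flip (L + 1) F, sum_comm]
  have hL : ∀ j ∈ range (L + 1), ∑ i ∈ range (L + 1),
      q ^ (T i + T j) * (-z ^ 2) ^ j * gauss q (L - j) i * gauss q i j =
        if 2 * j ≤ L then z ^ (2 * j) * ((-1) ^ j * q ^ (T j + T j) *
          gauss (q ^ 2) (L - 2 * j + j) j * qFactNeg q (L - 2 * j)) else 0 := by
    intro j hj
    split_ifs with h
    · obtain ⟨D, rfl⟩ := Nat.exists_eq_add_of_le' h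
      have h' := sum_T_mul_gauss_mul_gauss_eq_gauss_sq hq (show D + j ≤ D + 2 * j by omega)
      rw [show D + 2 * j - j = D + j by omega, Nat.add_sub_cancel]
      calc _ = q ^ T j * (-z ^ 2) ^ j *
            ∑ i ∈ range (D + 2 * j + 1), q ^ T i * gauss q (D + j) i * gauss q i j := by
            rw [mul_sum]
            exact sum_congr rfl fun i _ => by ring
        _ = _ := by
            rw [h', neg_pow]
            ring
    · refine sum_eq_zero fun i _ => ?_
      rcases (show L - j < i ∨ i < j by omega) with h' | h'
      · rw [gauss_eq_zero_of_lt q h']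
        ring
      · rw [gauss_eq_zero_of_lt q h']
        ring
  rw [sum_congr rfl hL, ← sum_range_ite_even L fun j => z ^ (2 * j) * ((-1) ^ j *
    q ^ (T j + T j) * gauss (q ^ 2) (L - 2 * j + j) j * qFactNeg q (L - 2 * j))]
  refine sum_congr rfl fun n hn => ?_
  obtain ⟨D, rfl⟩ := Nat.exists_eq_add_of_le' (Nat.lt_succ_iff.1 (mem_range.1 hn))
  have h := sum_antidiagonal_triple hq D n (D + n) le_rfl
  rw [← Nat.sum_antidiagonal_eq_sum_range_succ F n]
  have hF' : ∑ x ∈ antidiagonal n, F x.1 x.2 = z ^ n *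
      ∑ x ∈ antidiagonal n, (-1) ^ x.2 * q ^ (T x.1 + T x.2) * gauss q (D + x.2) x.2 *
        ∑ k ∈ range (D + n + 1),
          q ^ T k * gauss q (D + x.1) k * gauss q (D + x.1 + x.2 - k) x.1 := by
    rw [mul_sum]
    refine sum_congr rfl fun x hx => ?_
    have hx := HasAntidiagonal.mem_antidiagonal.1 hx
    simp only [F]
    rw [hx, show D + n - x.1 = D + x.2 by omega, show D + n - x.2 = D + x.1 by omega,
      show D + x.1 + x.2 = D + n by omega]
  rw [hF', h]
  split_ifs with he
  · rw [Nat.mul_div_cancel' he.two_dvd, Nat.add_sub_cancel]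
  · rw [mul_zero]

end Domain

open Polynomial in
/-- The polynomial Lebesgue identity over an arbitrary commutative ring. -/
theorem lebesgue_gauss {R : Type*} [CommRing R] (L : ℕ) (z q : R) :
    ∑ i ∈ range (L + 1), ∑ j ∈ range (L + 1),
        q ^ (T i + T j) * (-z ^ 2) ^ j * gauss q (L - j) i * gauss q i j =
      ∑ i ∈ range (L + 1), ∑ j ∈ range (L + 1), ∑ k ∈ range (L + 1),
        (-1) ^ j * z ^ (i + j) * q ^ (T i + T j + T k) *
          gauss q (L - i) j * gauss q (L - j) k * gauss q (L - k) i := by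
  have hX : ∀ n : ℕ, (C X : ℤ[X][X]) ^ (n + 1) ≠ 1 := by
    intro n h
    rw [← C_pow, ← C_1, C_inj] at h
    simpa using congrArg natDegree h
  obtain ⟨f, hz, hf⟩ : ∃ f : ℤ[X][X] →+* R, f X = z ∧ f (C X) = q :=
    ⟨eval₂RingHom (eval₂RingHom (Int.castRingHom R) q) z, by simp, by simp⟩
  have h := congrArg f (lebesgue_gauss_of_isDomain hX L X)
  simpa only [map_sum, map_mul, map_pow, map_neg, map_one, map_gauss, hz, hf] using h

lemma qPoch_self {K : Type*} [Field K] (q : K) (n : ℕ) : qPoch q q n = qFact q n :=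
  prod_congr rfl fun i _ => by rw [pow_succ']

lemma qbinom_natCast {K : Type*} [Field K] {q : K} {L : ℕ}
    (hq : ∀ n : ℕ, 1 ≤ n → n ≤ L → q ^ n ≠ 1) {m : ℕ} (n : ℕ) (hm : m ≤ L) :
    qbinom q m n = gauss q m n := by
  have hne : ∀ k ≤ L, qFact q k ≠ 0 := fun k hk => prod_ne_zero_iff.2 fun i hi =>
    sub_ne_zero.2 (hq (i + 1) (by omega) (by have := mem_range.1 hi; omega)).symm
  rw [qbinom]
  split_ifs with h
  · obtain ⟨d, rfl⟩ := Nat.exists_eq_add_of_le (show n ≤ m by omega)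
    rw [show ((n + d : ℕ) : ℤ) - n = (d : ℕ) by push_cast; ring]
    simp only [Int.toNat_natCast, qPoch_self]
    rw [div_eq_iff (mul_ne_zero (hne _ (by omega)) (hne _ (by omega))), gauss_mul_qFact]
  · rw [gauss_eq_zero_of_lt q (by omega)]

/-- Polynomial analogue of Lebesgue's identity. -/
theorem stmt9 {K : Type*} [Field K] (L : ℕ) (z q : K)
    (hq : ∀ n : ℕ, 1 ≤ n → n ≤ L → q ^ n ≠ 1) :
    ∑ i ∈ Finset.range (L + 1), ∑ j ∈ Finset.range (L + 1),
        q ^ (T i + T j) * (-z ^ 2) ^ j *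
          qbinom q ((L : ℤ) - j) i * qbinom q (i : ℤ) (j : ℤ)
      = ∑ i ∈ Finset.range (L + 1), ∑ j ∈ Finset.range (L + 1),
          ∑ k ∈ Finset.range (L + 1),
            (-1 : K) ^ j * z ^ (i + j) * q ^ (T i + T j + T k) *
              qbinom q ((L : ℤ) - i) j * qbinom q ((L : ℤ) - j) k *
              qbinom q ((L : ℤ) - k) i := by
  have hb : ∀ {a : ℕ}, a ∈ Finset.range (L + 1) → ∀ c : ℕ,
      qbinom q ((L : ℤ) - a) c = gauss q (L - a) c := by
    intro a ha c
    rw [← Nat.cast_sub (Nat.lt_succ_iff.1 (mem_range.1 ha)), qbinom_natCast hq c (Nat.sub_le L a)]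
  have h := lebesgue_gauss L z q
  convert h using 1
  · refine sum_congr rfl fun i hi => sum_congr rfl fun j hj => ?_
    rw [hb hj, qbinom_natCast hq j (Nat.lt_succ_iff.1 (mem_range.1 hi))]
  · refine sum_congr rfl fun i hi => sum_congr rfl fun j hj => sum_congr rfl fun k hk => ?_
    rw [hb hi, hb hj, hb hk]
end

section
/- (Andrews's generalization of Euler's theorem) For all nonnegative integers n and j, E(n,j) = ∑_{k≥j} C(k,j) V(n,k), where E(n,j) is the number of partitions of n having exactly j (distinct) even parts and all other parts odd and distinct among evens only (precisely: partitions of n into odd parts together with j distinct even parts), and V(n,k) is the number of partitions of n into distinct parts having exactly k maximal chains of consecutive integers none of which contains 1. -/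
/-- `E n j`: the number of partitions of `n` whose even parts are distinct and
exactly `j` in number (odd parts unrestricted). -/
noncomputable def E (n j : ℕ) : ℕ :=
  Nat.card {p : n.Partition //
    (∀ x ∈ p.parts, Even x → Multiset.count x p.parts = 1) ∧
      Multiset.card (p.parts.filter (fun x => Even x)) = j}

/-- `V n k`: the number of partitions of `n` into distinct parts whose chain
decomposition (into maximal runs of consecutive integers) has exactly `k`
chains not containing the part `1`; a chain not containing `1` corresponds to
a part `s > 1` with `s - 1` not a part. -/
noncomputable def V (n k : ℕ) : ℕ :=
  Nat.card {p : n.Partition //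
    p.parts.Nodup ∧
      (p.parts.toFinset.filter
        (fun s => 1 < s ∧ s - 1 ∉ p.parts.toFinset)).card = k}

/-- The finite sets `A` of integers exceeding `N` with `c * ∑ A = n`. -/
def scaledSumSets (c N n : ℕ) : Finset (Finset ℕ) :=
  (Finset.Ioc N n).powerset.filter fun A => c * ∑ a ∈ A, a = n

lemma mem_scaledSumSets {c N n : ℕ} (hc : 0 < c) {A : Finset ℕ} :
    A ∈ scaledSumSets c N n ↔ (∀ a ∈ A, N < a) ∧ c * ∑ a ∈ A, a = n := by
  simp only [scaledSumSets, Finset.mem_filter, Finset.mem_powerset]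
  refine and_congr_left fun h => ⟨fun hA a ha => (Finset.mem_Ioc.1 (hA ha)).1, fun hA a ha => ?_⟩
  have h1 : a ≤ ∑ a ∈ A, a := Finset.single_le_sum (f := fun a => a) (fun _ _ => Nat.zero_le _) ha
  have h2 : ∑ a ∈ A, a ≤ c * ∑ a ∈ A, a := Nat.le_mul_of_pos_left _ hc
  exact Finset.mem_Ioc.2 ⟨hA a ha, by omega⟩

/-- The generating function of the finite sets of integers exceeding `N`, where `A` has
weight `f A` and degree `c * ∑ A`. -/
noncomputable def setGenFun (c N : ℕ) (f : Finset ℕ → ℤ) : PowerSeries ℤ :=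
  PowerSeries.mk fun n => ∑ A ∈ scaledSumSets c N n, f A

lemma setGenFun_congr {c N : ℕ} (hc : 0 < c) {f g : Finset ℕ → ℤ}
    (h : ∀ A : Finset ℕ, (∀ a ∈ A, N < a) → f A = g A) : setGenFun c N f = setGenFun c N g := by
  ext n
  simp only [setGenFun, PowerSeries.coeff_mk]
  exact Finset.sum_congr rfl fun A hA => h A ((mem_scaledSumSets hc).1 hA).1

lemma setGenFun_add (c N : ℕ) (f g : Finset ℕ → ℤ) :
    setGenFun c N (fun A => f A + g A) = setGenFun c N f + setGenFun c N g := by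
  ext n
  simp [setGenFun, Finset.sum_add_distrib]

/-- Splitting according to whether the least admissible element `N + 1` belongs to the set. -/
lemma setGenFun_succ {c : ℕ} (hc : 0 < c) (N : ℕ) (f : Finset ℕ → ℤ) :
    setGenFun c N f = setGenFun c (N + 1) f +
      PowerSeries.X ^ (c * (N + 1)) * setGenFun c (N + 1) (fun A => f (insert (N + 1) A)) := by
  ext n
  simp only [setGenFun, PowerSeries.coeff_mk, map_add, PowerSeries.coeff_X_pow_mul']
  rw [← Finset.sum_filter_add_sum_filter_not (scaledSumSets c N n) (fun A => N + 1 ∉ A)]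
  congr 1
  · refine Finset.sum_congr ?_ fun _ _ => rfl
    ext A
    simp only [Finset.mem_filter, mem_scaledSumSets hc]
    constructor
    · rintro ⟨⟨h1, h2⟩, h3⟩
      refine ⟨fun a ha => ?_, h2⟩
      have := h1 a ha
      have : a ≠ N + 1 := fun h => h3 (h ▸ ha)
      omega
    · rintro ⟨h1, h2⟩
      exact ⟨⟨fun a ha => (Nat.lt_succ_self N).trans (h1 a ha), h2⟩, fun h => lt_irrefl _ (h1 _ h)⟩
  · split_ifs with hn
    · refine Finset.sum_bij' (fun A _ => A.erase (N + 1)) (fun A _ => insert (N + 1) A)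
        ?_ ?_ ?_ ?_ ?_
      · intro A hA
        simp only [Finset.mem_filter, mem_scaledSumSets hc, not_not] at hA ⊢
        obtain ⟨⟨h1, h2⟩, h3⟩ := hA
        refine ⟨fun a ha => ?_, ?_⟩
        · have := h1 a (Finset.mem_of_mem_erase ha)
          have := Finset.ne_of_mem_erase ha
          omega
        · have := Finset.add_sum_erase A (fun a => a) h3
          rw [← h2, ← this, mul_add]
          omega
      · intro A hA
        simp only [Finset.mem_filter, mem_scaledSumSets hc, not_not] at hA ⊢
        obtain ⟨h1, h2⟩ := hA
        have h3 : N + 1 ∉ A := fun h => lt_irrefl _ (h1 _ h)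
        refine ⟨⟨fun a ha => ?_, ?_⟩, Finset.mem_insert_self _ _⟩
        · rcases Finset.mem_insert.1 ha with rfl | ha
          · omega
          · have := h1 a ha
            omega
        · rw [Finset.sum_insert h3, mul_add, h2]
          omega
      · intro A hA
        simp only [Finset.mem_filter, not_not] at hA
        exact Finset.insert_erase hA.2
      · intro A hA
        exact Finset.erase_insert fun h => lt_irrefl _ (((mem_scaledSumSets hc).1 hA).1 _ h)
      · intro A hA
        simp only [Finset.mem_filter, not_not] at hA
        rw [Finset.insert_erase hA.2]
    · refine Finset.sum_eq_zero fun A hA => absurd ?_ hn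
      simp only [Finset.mem_filter, mem_scaledSumSets hc, not_not] at hA
      rw [← hA.1.2]
      exact Nat.mul_le_mul_left _
        (Finset.single_le_sum (f := fun a => a) (fun _ _ => Nat.zero_le _) hA.2)

lemma X_pow_dvd_setGenFun (c N : ℕ) {f : Finset ℕ → ℤ} (hf : f ∅ = 0) :
    PowerSeries.X ^ N ∣ setGenFun c N f := by
  rw [PowerSeries.X_pow_dvd_iff]
  intro n hn
  simp only [setGenFun, PowerSeries.coeff_mk, scaledSumSets, Finset.Ioc_eq_empty_of_le hn.le]
  refine Finset.sum_eq_zero fun A hA => ?_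
  rw [Finset.mem_filter, Finset.mem_powerset, Finset.subset_empty] at hA
  rw [hA.1, hf]

lemma eq_zero_of_forall_X_pow_dvd {D : ℕ → PowerSeries ℤ} (h : ∀ N, D (N + 1) ∣ D N)
    (hX : ∀ N, PowerSeries.X ^ N ∣ D N) (N : ℕ) : D N = 0 := by
  have hD : ∀ k, D (N + k) ∣ D N := fun k => by
    induction k with
    | zero => exact dvd_rfl
    | succ k ih => exact (h (N + k)).trans ih
  ext n
  have : PowerSeries.X ^ (n + 1) ∣ D N :=
    ((pow_dvd_pow _ (by omega)).trans (hX (N + (n + 1)))).trans (hD (n + 1))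
  simpa using PowerSeries.X_pow_dvd_iff.1 this n n.lt_succ_self

/-- The finite `q`-Pochhammer symbol `(q^c; q^c)_j`. -/
noncomputable def qFactorial (c j : ℕ) : PowerSeries ℤ :=
  ∏ i ∈ Finset.range j, (1 - PowerSeries.X ^ (c * (i + 1)))

lemma qFactorial_succ (c j : ℕ) :
    qFactorial c (j + 1) = qFactorial c j * (1 - PowerSeries.X ^ (c * (j + 1))) :=
  Finset.prod_range_succ _ _

lemma qFactorial_ne_zero {c : ℕ} (hc : 0 < c) (j : ℕ) : qFactorial c j ≠ 0 := by
  refine Finset.prod_ne_zero_iff.2 fun i _ h => ?_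
  have := congrArg (PowerSeries.coeff 0) h
  rw [map_sub, PowerSeries.coeff_X_pow, if_neg (by positivity)] at this
  simp at this

/-- The generating function of sets of exactly `j` integers exceeding `N`. -/
noncomputable def cardGenFun (c j N : ℕ) : PowerSeries ℤ :=
  setGenFun c N fun A => if A.card = j then 1 else 0

lemma cardGenFun_zero {c : ℕ} (hc : 0 < c) (N : ℕ) : cardGenFun c 0 N = 1 := by
  ext n
  simp only [cardGenFun, setGenFun, PowerSeries.coeff_mk, Finset.card_eq_zero,
    Finset.sum_ite_eq', mem_scaledSumSets hc, PowerSeries.coeff_one]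
  simp [eq_comm]

lemma cardGenFun_succ {c : ℕ} (hc : 0 < c) (j N : ℕ) :
    cardGenFun c (j + 1) N = cardGenFun c (j + 1) (N + 1) +
      PowerSeries.X ^ (c * (N + 1)) * cardGenFun c j (N + 1) := by
  rw [cardGenFun, setGenFun_succ hc]
  congr 2
  refine setGenFun_congr hc fun A hA => ?_
  rw [Finset.card_insert_of_notMem fun h => lt_irrefl _ (hA _ h)]
  simp

lemma qFactorial_mul_cardGenFun (j N : ℕ) :
    qFactorial 2 j * cardGenFun 2 j N = PowerSeries.X ^ (j * (j + 1) + 2 * N * j) := by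
  induction j generalizing N with
  | zero => simp [qFactorial, cardGenFun_zero]
  | succ j ih =>
    rw [← sub_eq_zero]
    refine eq_zero_of_forall_X_pow_dvd (D := fun N => qFactorial 2 (j + 1) *
      cardGenFun 2 (j + 1) N - PowerSeries.X ^ ((j + 1) * (j + 1 + 1) + 2 * N * (j + 1)))
      (fun N => ?_) (fun N => ?_) N
    · refine dvd_of_eq ?_
      rw [cardGenFun_succ two_pos j N]
      have h := ih (N + 1)
      rw [qFactorial_succ]
      linear_combination (-(1 - PowerSeries.X ^ (2 * (j + 1))) *
        PowerSeries.X ^ (2 * (N + 1))) * h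
    · refine dvd_sub (Dvd.dvd.mul_left (X_pow_dvd_setGenFun _ _ (by simp)) _)
        (pow_dvd_pow _ ?_)
      nlinarith

/-- The number of runs of consecutive integers in `A` that start beyond `N + 1`. -/
def chainCount (N : ℕ) (A : Finset ℕ) : ℕ :=
  (A.filter fun s => N + 1 < s ∧ s - 1 ∉ A).card

lemma chainCount_insert_self {N : ℕ} {A : Finset ℕ} (hA : ∀ a ∈ A, N + 1 < a) :
    chainCount N (insert (N + 1) A) = chainCount (N + 1) A := by
  unfold chainCount
  congr 1
  ext s
  have := hA s
  simp only [Finset.mem_filter, Finset.mem_insert]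
  grind

lemma chainCount_eq_succ {N : ℕ} {A : Finset ℕ} (hA : ∀ a ∈ A, N + 2 < a) :
    chainCount N A = chainCount (N + 1) A := by
  unfold chainCount
  congr 1
  ext s
  have := hA s
  simp only [Finset.mem_filter]
  grind

lemma chainCount_insert_add_two {N : ℕ} {A : Finset ℕ} (hA : ∀ a ∈ A, N + 2 < a) :
    chainCount N (insert (N + 2) A) = chainCount (N + 2) A + 1 := by
  rw [← chainCount_insert_self hA]
  unfold chainCount
  rw [← Finset.card_insert_of_notMem (a := N + 2) (by simp)]
  congr 1
  ext s
  have := hA s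
  have := hA (s - 1)
  simp only [Finset.mem_filter, Finset.mem_insert]
  grind

/-- The generating function of sets of integers exceeding `N` with `j` marked chains that
start beyond `N + 1`. -/
noncomputable def markedGenFun (j N : ℕ) : PowerSeries ℤ :=
  setGenFun 1 N fun A => ((chainCount N A).choose j : ℤ)

lemma markedGenFun_zero (N : ℕ) :
    markedGenFun 0 N = (1 + PowerSeries.X ^ (N + 1)) * markedGenFun 0 (N + 1) := by
  simp only [markedGenFun, Nat.choose_zero_right]
  rw [setGenFun_succ one_pos, one_mul]
  ring

lemma markedGenFun_succ (j N : ℕ) :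
    markedGenFun (j + 1) N = (1 + PowerSeries.X ^ (N + 1)) * markedGenFun (j + 1) (N + 1) +
      PowerSeries.X ^ (N + 2) * markedGenFun j (N + 2) := by
  have h1 : setGenFun 1 (N + 1) (fun A => ((chainCount N (insert (N + 1) A)).choose (j + 1) : ℤ))
      = markedGenFun (j + 1) (N + 1) :=
    setGenFun_congr one_pos fun A hA => by rw [chainCount_insert_self hA]
  have h2 : setGenFun 1 (N + 2) (fun A => ((chainCount N A).choose (j + 1) : ℤ))
      = setGenFun 1 (N + 2) (fun A => ((chainCount (N + 1) A).choose (j + 1) : ℤ)) :=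
    setGenFun_congr one_pos fun A hA => by rw [chainCount_eq_succ hA]
  have h3 : setGenFun 1 (N + 2)
        (fun A => ((chainCount N (insert (N + 2) A)).choose (j + 1) : ℤ))
      = markedGenFun j (N + 2) + setGenFun 1 (N + 2)
        (fun A => ((chainCount (N + 1) (insert (N + 2) A)).choose (j + 1) : ℤ)) := by
    rw [markedGenFun, ← setGenFun_add]
    refine setGenFun_congr one_pos fun A hA => ?_
    rw [chainCount_insert_add_two hA, chainCount_insert_self hA, Nat.choose_succ_succ]
    push_cast
    rfl
  have h4 : markedGenFun (j + 1) (N + 1) = _ := setGenFun_succ one_pos _ _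
  rw [markedGenFun, setGenFun_succ one_pos, h1, setGenFun_succ one_pos, h2, h3, one_mul, one_mul]
  rw [one_mul] at h4
  linear_combination -h4

lemma qFactorial_mul_markedGenFun (j N : ℕ) :
    qFactorial 1 j * markedGenFun j N =
      PowerSeries.X ^ (j * (j + 1) + N * j) * markedGenFun 0 (N + j) := by
  induction j generalizing N with
  | zero => simp [qFactorial]
  | succ j ih =>
    rw [← sub_eq_zero]
    refine eq_zero_of_forall_X_pow_dvd (D := fun N => qFactorial 1 (j + 1) *
      markedGenFun (j + 1) N - PowerSeries.X ^ ((j + 1) * (j + 1 + 1) + N * (j + 1)) *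
        markedGenFun 0 (N + (j + 1))) (fun N => ?_) (fun N => ?_) N
    · refine Dvd.intro_left (1 + PowerSeries.X ^ (N + 1)) ?_
      have h := ih (N + 2)
      have h0 := markedGenFun_zero (N + (j + 1))
      rw [markedGenFun_succ j N, h0, qFactorial_succ]
      rw [show N + 2 + j = N + (j + 1) + 1 by ring] at h
      rw [show N + 1 + (j + 1) = N + (j + 1) + 1 by ring, one_mul]
      linear_combination (-(1 - PowerSeries.X ^ (j + 1)) * PowerSeries.X ^ (N + 2)) * h
    · refine dvd_sub (Dvd.dvd.mul_left (X_pow_dvd_setGenFun _ _ (by simp [chainCount])) _)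
        (Dvd.dvd.mul_right (pow_dvd_pow _ ?_) _)
      nlinarith

lemma qFactorial_one_mul_markedGenFun_zero (j : ℕ) :
    qFactorial 1 j * markedGenFun 0 0 = qFactorial 2 j * markedGenFun 0 j := by
  induction j with
  | zero => simp [qFactorial]
  | succ j ih =>
    rw [markedGenFun_zero j] at ih
    rw [qFactorial_succ, qFactorial_succ]
    linear_combination (1 - PowerSeries.X ^ (1 * (j + 1))) * ih

lemma markedGenFun_eq_cardGenFun_mul (j : ℕ) :
    markedGenFun j 0 = cardGenFun 2 j 0 * markedGenFun 0 0 := by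
  have h1 := qFactorial_mul_markedGenFun j 0
  have h2 := qFactorial_mul_cardGenFun j 0
  have h3 := qFactorial_one_mul_markedGenFun_zero j
  simp only [mul_zero, zero_mul, add_zero, zero_add] at h1 h2
  refine mul_left_cancel₀ (mul_ne_zero (qFactorial_ne_zero one_pos j)
    (qFactorial_ne_zero two_pos j)) ?_
  linear_combination qFactorial 2 j * h1 - qFactorial 1 j * markedGenFun 0 0 * h2 -
    PowerSeries.X ^ (j * (j + 1)) * h3

lemma sum_distincts (n : ℕ) (f : Finset ℕ → ℤ) :
    ∑ p ∈ Nat.Partition.distincts n, f p.parts.toFinset = ∑ A ∈ scaledSumSets 1 0 n, f A := by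
  refine Finset.sum_bij (fun p _ => p.parts.toFinset) ?_ ?_ ?_ fun _ _ => rfl
  · intro p hp
    have hp : p.parts.Nodup := by simpa [Nat.Partition.distincts] using hp
    refine (mem_scaledSumSets one_pos).2 ⟨fun a ha => p.parts_pos (by simpa using ha), ?_⟩
    rw [one_mul, Finset.sum_eq_multiset_sum, Multiset.toFinset_val, hp.dedup, Multiset.map_id']
    exact p.parts_sum
  · intro p hp p' hp' h
    have hp : p.parts.Nodup := by simpa [Nat.Partition.distincts] using hp
    have hp' : p'.parts.Nodup := by simpa [Nat.Partition.distincts] using hp'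
    have := congrArg Finset.val h
    rw [Multiset.toFinset_val, Multiset.toFinset_val, hp.dedup, hp'.dedup] at this
    exact Nat.Partition.ext this
  · intro A hA
    obtain ⟨h1, h2⟩ := (mem_scaledSumSets one_pos).1 hA
    refine ⟨⟨A.val, fun {i} hi => h1 i hi, ?_⟩, ?_, ?_⟩
    · rwa [one_mul, Finset.sum_eq_multiset_sum, Multiset.map_id'] at h2
    · exact Finset.mem_filter.2 ⟨Finset.mem_univ _, A.nodup⟩
    · simp

lemma coeff_markedGenFun_zero (n : ℕ) :
    PowerSeries.coeff n (markedGenFun 0 0) = (Nat.Partition.odds n).card := by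
  rw [Nat.Partition.card_odds_eq_card_distincts, Finset.card_eq_sum_ones]
  simp only [markedGenFun, setGenFun, PowerSeries.coeff_mk, Nat.choose_zero_right, Nat.cast_one]
  rw [← sum_distincts n fun _ => 1]
  simp

lemma sum_choose_mul_V (n j : ℕ) :
    ((∑ k ∈ Finset.range (n + 1), Nat.choose k j * V n k : ℕ) : ℤ) =
      PowerSeries.coeff n (markedGenFun j 0) := by
  simp only [markedGenFun, setGenFun, PowerSeries.coeff_mk]
  rw [← sum_distincts n fun A => ((chainCount 0 A).choose j : ℤ)]
  have hV : ∀ k, V n k =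
      ((Nat.Partition.distincts n).filter fun p => chainCount 0 p.parts.toFinset = k).card := by
    intro k
    rw [V, Nat.card_eq_fintype_card, Fintype.card_subtype, Nat.Partition.distincts,
      Finset.filter_filter]
    rfl
  rw [← Finset.sum_fiberwise_of_maps_to (s := Nat.Partition.distincts n)
    (t := Finset.range (n + 1)) (g := fun p => chainCount 0 p.parts.toFinset)]
  · push_cast
    refine Finset.sum_congr rfl fun k _ => ?_
    rw [hV, Finset.sum_congr rfl (g := fun _ => (k.choose j : ℤ))
      fun p hp => by rw [(Finset.mem_filter.1 hp).2]]
    rw [Finset.sum_const, nsmul_eq_mul, mul_comm]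
  · intro p _
    refine Finset.mem_range_succ_iff.2 ((Finset.card_filter_le _ _).trans ?_)
    have : p.parts.toFinset ⊆ Finset.Ioc 0 n := fun a ha => by
      rw [Multiset.mem_toFinset] at ha
      exact Finset.mem_Ioc.2 ⟨p.parts_pos ha, p.le_of_mem_parts ha⟩
    simpa using Finset.card_le_card this

/-- A partition with `j` distinct even parts is a set of `j` even numbers and a partition into
odd parts. -/
lemma card_evenDistinct_fiber {n a b : ℕ} (hab : a + b = n) (j : ℕ) :
    (Finset.univ.filter fun p : n.Partition =>
      ((∀ x ∈ p.parts, Even x → Multiset.count x p.parts = 1) ∧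
        Multiset.card (p.parts.filter (fun x => Even x)) = j) ∧
        (p.parts.filter (fun x => Even x)).sum = a).card =
    ((scaledSumSets 2 0 a).filter fun A => A.card = j).card * (Nat.Partition.odds b).card := by
  rw [← Finset.card_product]
  symm
  have hodd : ∀ o ∈ Nat.Partition.odds b, ∀ x ∈ o.parts, ¬ Even x := fun o ho => by
    simpa only [Nat.Partition.odds, Nat.Partition.restricted, Finset.mem_filter,
      Finset.mem_univ, true_and] using ho
  have hfilter : ∀ (A : Finset ℕ), ∀ o ∈ Nat.Partition.odds b,
      (A.val.map (2 * ·) + o.parts).filter (fun x => Even x) = A.val.map (2 * ·) := by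
    intro A o ho
    rw [Multiset.filter_add, Multiset.filter_eq_self.2, Multiset.filter_eq_nil.2 (hodd o ho),
      add_zero]
    intro x hx
    obtain ⟨y, -, rfl⟩ := Multiset.mem_map.1 hx
    exact even_two_mul y
  have hsum : ∀ A : Finset ℕ, (A.val.map (2 * ·)).sum = 2 * ∑ x ∈ A, x := fun A => by
    rw [Finset.mul_sum]
    rfl
  have hmul : Function.Injective fun x : ℕ => 2 * x := fun x y h => by
    simpa using h
  refine Finset.card_bij (fun q hq => ⟨q.1.val.map (2 * ·) + q.2.parts, ?_, ?_⟩) ?_ ?_ ?_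
  · intro i hi
    simp only [Finset.mem_product, Finset.mem_filter, mem_scaledSumSets two_pos] at hq
    rcases Multiset.mem_add.1 hi with hi | hi
    · obtain ⟨y, hy, rfl⟩ := Multiset.mem_map.1 hi
      have := hq.1.1.1 y hy
      omega
    · exact q.2.parts_pos hi
  · simp only [Finset.mem_product, Finset.mem_filter, mem_scaledSumSets two_pos] at hq
    rw [Multiset.sum_add, hsum, hq.1.1.2, q.2.parts_sum, hab]
  · intro q hq
    simp only [Finset.mem_product, Finset.mem_filter, mem_scaledSumSets two_pos] at hq
    simp only [Finset.mem_filter, Finset.mem_univ, true_and]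
    rw [hfilter _ _ hq.2, hsum, Multiset.card_map]
    refine ⟨⟨fun x hx hxe => ?_, hq.1.2⟩, hq.1.1.2⟩
    have hx' : x ∉ q.2.parts := fun h => hodd _ hq.2 x h hxe
    rw [Multiset.count_add, Multiset.count_eq_zero_of_notMem hx', add_zero]
    exact Multiset.count_eq_one_of_mem (q.1.nodup.map hmul)
      ((Multiset.mem_add.1 hx).resolve_right hx')
  · intro q hq q' hq' h
    have hp := congrArg Nat.Partition.parts h
    simp only at hp
    have ho := (Finset.mem_product.1 hq).2
    have ho' := (Finset.mem_product.1 hq').2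
    have he := congrArg (Multiset.filter fun x => Even x) hp
    rw [hfilter _ _ ho, hfilter _ _ ho'] at he
    rw [he] at hp
    exact Prod.ext (Finset.val_injective (Multiset.map_injective hmul he))
      (Nat.Partition.ext (add_left_cancel hp))
  · intro p hp
    simp only [Finset.mem_filter, Finset.mem_univ, true_and] at hp
    obtain ⟨⟨h1, h2⟩, h3⟩ := hp
    have hmap : ((p.parts.filter fun x => Even x).map (· / 2)).map (2 * ·) =
        p.parts.filter fun x => Even x := by
      rw [Multiset.map_map]
      conv_rhs => rw [← Multiset.map_id (p.parts.filter fun x => Even x)]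
      refine Multiset.map_congr rfl fun x hx => ?_
      exact Nat.two_mul_div_two_of_even (Multiset.mem_filter.1 hx).2
    have hnodup : ((p.parts.filter fun x => Even x).map (· / 2)).Nodup := by
      refine Multiset.Nodup.of_map (2 * ·) ?_
      rw [hmap, Multiset.nodup_iff_count_eq_one]
      intro x hx
      obtain ⟨hx, hxe⟩ := Multiset.mem_filter.1 hx
      rw [Multiset.count_filter_of_pos hxe, h1 x hx hxe]
    have hadd := Multiset.filter_add_not (fun x => Even x) p.parts
    have hsplit := congrArg Multiset.sum hadd
    rw [Multiset.sum_add, p.parts_sum, h3] at hsplit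
    refine ⟨(⟨_, hnodup⟩, ⟨p.parts.filter fun x => ¬ Even x,
      fun {i} hi => p.parts_pos (Multiset.mem_filter.1 hi).1, by omega⟩), ?_, ?_⟩
    · simp only [Finset.mem_product, Finset.mem_filter, mem_scaledSumSets two_pos]
      refine ⟨⟨⟨fun x hx => ?_, ?_⟩, ?_⟩, ?_⟩
      · obtain ⟨y, hy, rfl⟩ := Multiset.mem_map.1 (Finset.mem_def.1 hx)
        obtain ⟨hy, k, rfl⟩ := Multiset.mem_filter.1 hy
        have := p.parts_pos hy
        omega
      · rw [← hsum, hmap, h3]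
      · rw [Finset.card_mk, Multiset.card_map, h2]
      · simp [Nat.Partition.odds, Nat.Partition.restricted]
    · refine Nat.Partition.ext ?_
      simp only [hmap, hadd]

lemma cast_E (n j : ℕ) :
    (E n j : ℤ) = PowerSeries.coeff n (cardGenFun 2 j 0 * markedGenFun 0 0) := by
  rw [E, Nat.card_eq_fintype_card, Fintype.card_subtype,
    Finset.card_eq_sum_card_fiberwise (t := Finset.HasAntidiagonal.antidiagonal n)
      (f := fun p : n.Partition => ((p.parts.filter fun x => Even x).sum,
        (p.parts.filter fun x => ¬ Even x).sum)), PowerSeries.coeff_mul, Nat.cast_sum]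
  · refine Finset.sum_congr rfl fun q hq => ?_
    rw [Finset.HasAntidiagonal.mem_antidiagonal] at hq
    rw [coeff_markedGenFun_zero, cardGenFun, setGenFun, PowerSeries.coeff_mk, Finset.sum_boole,
      ← Nat.cast_mul, ← card_evenDistinct_fiber hq, Finset.filter_filter]
    congr 2
    refine Finset.filter_congr fun p _ => and_congr_right fun _ => ?_
    have hsplit := congrArg Multiset.sum (Multiset.filter_add_not (fun x => Even x) p.parts)
    rw [Multiset.sum_add, p.parts_sum] at hsplit
    rw [Prod.ext_iff]
    refine ⟨fun h => h.1, fun h => ⟨h, ?_⟩⟩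
    simp only
    omega
  · intro p _
    have hsplit := congrArg Multiset.sum (Multiset.filter_add_not (fun x => Even x) p.parts)
    rw [Multiset.sum_add, p.parts_sum] at hsplit
    simpa using hsplit

/-- Andrews's generalization of Euler's partition theorem:
`E(n,j) = ∑_{k ≥ j} C(k,j) V(n,k)`. -/
theorem stmt19 (n j : ℕ) :
    E n j = ∑ k ∈ Finset.range (n + 1), Nat.choose k j * V n k := by
  have h := sum_choose_mul_V n j
  rw [markedGenFun_eq_cardGenFun_mul, ← cast_E] at h
  exact_mod_cast h.symm
end
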